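/- Let d ≥ 2, let L : B(0,1)×S^{d−1} → ℝ^{d×d} be a map such that (z,ω) ↦ |z|·L(z,ω) is bounded and Lipschitz on B(0,1)×S^{d−1}, and assume L satisfies the cancellation condition: there exists α ∈ ℝ such that ∫_{B(0,1)} L(z,ω) |z|^{1−d} dz = α ( ω⊗ω − (1/d) I_d ) for every ω ∈ S^{d−1}. Then for every 1 < q < ∞ there exists a constant C, independent of h, such that for every h ∈ (0,1/2) and every Schwartz function A : ℝ^d → ℝ^{d×d}: ‖ Q(A,1) ‖_{L^q(ℝ^d)} ≤ C ‖A‖_{L^q(ℝ^d)}, where Q(A,1) is the operator Q applied with g ≡ 1. -/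

import Mathlib

open MeasureTheory

/-- The operator
`Q(A,g)(x) = ∫₀¹∫_{B(0,1)}∫_{S^{d−1}} (r^d/(r+h)^{d+1}) L(z,ω):A(x+rz) g(x+rω) dσ(ω) |z|^{1−d} dz dr`,
where matrices are encoded as elements of `EuclideanSpace ℝ (Fin d × Fin d)` and `σ` is the
`(d−1)`-dimensional Hausdorff (surface) measure on the unit sphere. -/
noncomputable def Qop (d : ℕ) (h : ℝ)
    (L : EuclideanSpace ℝ (Fin d) → EuclideanSpace ℝ (Fin d) →
      EuclideanSpace ℝ (Fin d × Fin d))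
    (A : EuclideanSpace ℝ (Fin d) → EuclideanSpace ℝ (Fin d × Fin d))
    (g : EuclideanSpace ℝ (Fin d) → ℝ)
    (x : EuclideanSpace ℝ (Fin d)) : ℝ :=
  ∫ r in Set.Ioc (0 : ℝ) 1,
    ∫ z in Metric.ball (0 : EuclideanSpace ℝ (Fin d)) 1,
      ∫ ω in Metric.sphere (0 : EuclideanSpace ℝ (Fin d)) 1,
        (r ^ d / (r + h) ^ (d + 1)) * (‖z‖ ^ (1 - (d : ℝ))) *
          (∑ kl : Fin d × Fin d, L z ω kl * A (x + r • z) kl) * g (x + r • ω)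
        ∂(μH[(d : ℝ) - 1])

open scoped ENNReal FourierTransform Convolution

section ConvolutionL2

variable {E : Type*} [NormedAddCommGroup E] [InnerProductSpace ℝ E] [FiniteDimensional ℝ E]
  [MeasurableSpace E] [BorelSpace E]

theorem convolution_real_apply (K f : E → ℝ) (x : E) :
    (K ⋆ f) x = ∫ y, K y * f (x - y) := by
  simp [convolution_lsmul]

theorem convolution_real_apply_swap (K f : E → ℝ) (x : E) :
    (K ⋆ f) x = ∫ y, K (x - y) * f y := by
  simp [convolution_lsmul_swap]

/-- Translation by `y` on `L²(E; ℂ)`. -/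
noncomputable def translateL2 (y : E) (u : Lp ℂ 2 (volume : Measure E)) :
    Lp ℂ 2 (volume : Measure E) :=
  Lp.compMeasurePreserving (fun x => x - y) (measurePreserving_sub_right volume y) u

theorem norm_translateL2 (y : E) (u : Lp ℂ 2 (volume : Measure E)) : ‖translateL2 y u‖ = ‖u‖ :=
  Lp.norm_compMeasurePreserving _ _

theorem translateL2_sub (y : E) (u v : Lp ℂ 2 (volume : Measure E)) :
    translateL2 y (u - v) = translateL2 y u - translateL2 y v :=
  map_sub _ _ _

theorem continuous_translateL2 (u : Lp ℂ 2 (volume : Measure E)) :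
    Continuous fun y => translateL2 y u := by
  have hg : Continuous (fun y : E => (⟨fun x => x - y, by fun_prop⟩ : C(E, E))) :=
    ContinuousMap.continuous_of_continuous_uncurry _ (by
      change Continuous fun p : E × E => p.2 - p.1
      fun_prop)
  exact Continuous.compMeasurePreservingLp (p := 2) (f := fun _ : E => u) continuous_const hg
    (fun y => measurePreserving_sub_right volume y) (by simp)

theorem integrable_smul_translateL2 {K : E → ℝ} (hK : Integrable K)
    (u : Lp ℂ 2 (volume : Measure E)) : Integrable fun y => (K y : ℂ) • translateL2 y u := by
  refine Integrable.mono' (hK.norm.mul_const ‖u‖)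
    (AEStronglyMeasurable.fun_smul hK.ofReal.aestronglyMeasurable
      (continuous_translateL2 u).aestronglyMeasurable) ?_
  refine Filter.Eventually.of_forall fun y => ?_
  rw [norm_smul, norm_translateL2, Complex.norm_real]

theorem translateL2_toLp (y : E) (f : SchwartzMap E ℂ) :
    translateL2 y (f.toLp 2) = (f.compSubConstCLM ℂ y).toLp 2 :=
  Lp.toLp_compMeasurePreserving (f.memLp 2) (measurePreserving_sub_right volume y)

theorem fourier_compSubConst (y ξ : E) (f : SchwartzMap E ℂ) :
    𝓕 (f.compSubConstCLM ℂ y) ξ = Real.fourierChar (-inner ℝ y ξ) • 𝓕 f ξ := by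
  rw [SchwartzMap.fourier_coe, SchwartzMap.fourier_coe]
  have := congrFun (VectorFourier.fourierIntegral_comp_add_right Real.fourierChar volume
    (innerₗ E) f (-y)) ξ
  simp only [innerₗ_apply_apply, inner_neg_left] at this
  have h2 : ⇑(f.compSubConstCLM ℂ y) = ⇑f ∘ fun v => v + -y := by
    ext x
    simp [sub_eq_add_neg]
  rw [h2]
  exact this

theorem inner_toLp_translateL2 (f g : SchwartzMap E ℂ) (y : E) :
    inner ℂ (g.toLp 2 volume) (translateL2 y (f.toLp 2)) =
      ∫ ξ, Real.fourierChar (-inner ℝ y ξ) • inner ℂ (𝓕 g ξ) (𝓕 f ξ) := by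
  rw [translateL2_toLp, ← SchwartzMap.inner_fourier_toL2_eq, L2.inner_def]
  refine integral_congr_ae ?_
  filter_upwards [(𝓕 g).coeFn_toLp 2 volume, (𝓕 (f.compSubConstCLM ℂ y)).coeFn_toLp 2 volume]
    with ξ h1 h2
  rw [h1, h2, fourier_compSubConst, Circle.smul_def, Circle.smul_def, inner_smul_right, smul_eq_mul]

theorem integral_inner_translateL2_schwartz {K : E → ℝ} (hK : Integrable K)
    (f g : SchwartzMap E ℂ) :
    ∫ y, (K y : ℂ) * inner ℂ (g.toLp 2 volume) (translateL2 y (f.toLp 2)) =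
      ∫ ξ, 𝓕 (fun y => (K y : ℂ)) ξ * inner ℂ (𝓕 g ξ) (𝓕 f ξ) := by
  have hInt : Integrable (fun ξ => inner ℂ (𝓕 g ξ) (𝓕 f ξ)) := by
    refine Integrable.congr (L2.integrable_inner ((𝓕 g).toLp 2 volume) ((𝓕 f).toLp 2 volume)) ?_
    filter_upwards [(𝓕 g).coeFn_toLp 2 volume, (𝓕 f).coeFn_toLp 2 volume] with ξ h1 h2
    rw [h1, h2]
  have hprod : Integrable (Function.uncurry fun y ξ : E =>
      (K y : ℂ) * (Real.fourierChar (-inner ℝ y ξ) • inner ℂ (𝓕 g ξ) (𝓕 f ξ)))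
      (volume.prod volume) := by
    have h0 := Integrable.mul_prod (L := ℂ) hK.ofReal hInt
    refine h0.mono ?_ ?_
    · have hc : Continuous fun p : E × E => (Real.fourierChar (-inner ℝ p.1 p.2) : ℂ) := by
        fun_prop
      refine AEStronglyMeasurable.congr (h0.aestronglyMeasurable.mul hc.aestronglyMeasurable) ?_
      refine Filter.Eventually.of_forall fun p => ?_
      simp only [Function.uncurry, Circle.smul_def, smul_eq_mul, Pi.mul_apply]
      rw [mul_assoc]
      congr 1
      exact mul_comm _ _
    · refine Filter.Eventually.of_forall fun p => ?_
      simp [Function.uncurry, Circle.norm_smul]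
  simp_rw [inner_toLp_translateL2, ← integral_const_mul]
  rw [integral_integral_swap hprod]
  refine integral_congr_ae (Filter.Eventually.of_forall fun ξ => ?_)
  simp only [Real.fourier_eq]
  rw [← integral_mul_const]
  refine integral_congr_ae (Filter.Eventually.of_forall fun y => ?_)
  simp only [Circle.smul_def, smul_eq_mul]
  ring

/-- The operator `u ↦ ∫ K(y) u(· - y) dy` on `L²`, as a Bochner integral. -/
noncomputable def averageL2 (K : E → ℝ) (u : Lp ℂ 2 (volume : Measure E)) :
    Lp ℂ 2 (volume : Measure E) :=
  ∫ y, (K y : ℂ) • translateL2 y u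

theorem continuous_averageL2 {K : E → ℝ} (hK : Integrable K) : Continuous (averageL2 K) := by
  refine LipschitzWith.continuous (K := (∫ y, ‖K y‖).toNNReal)
    (LipschitzWith.of_dist_le_mul fun u v => ?_)
  rw [dist_eq_norm, dist_eq_norm, averageL2, averageL2,
    ← integral_sub (integrable_smul_translateL2 hK u) (integrable_smul_translateL2 hK v),
    Real.coe_toNNReal _ (by positivity), ← integral_mul_const]
  refine norm_integral_le_of_norm_le (hK.norm.mul_const _) (Filter.Eventually.of_forall fun y => ?_)
  rw [← smul_sub, ← translateL2_sub, norm_smul, norm_translateL2]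
  simp

theorem inner_averageL2 {K : E → ℝ} (hK : Integrable K) (u v : Lp ℂ 2 (volume : Measure E)) :
    inner ℂ u (averageL2 K v) = ∫ y, (K y : ℂ) * inner ℂ u (translateL2 y v) := by
  rw [averageL2, ← integral_inner (integrable_smul_translateL2 hK v)]
  simp_rw [inner_smul_right]

theorem norm_inner_averageL2_le {K : E → ℝ} (hK : Integrable K) {B : ℝ}
    (hB : ∀ ξ, ‖𝓕 (fun y => (K y : ℂ)) ξ‖ ≤ B) (u v : Lp ℂ 2 (volume : Measure E)) :
    ‖inner ℂ u (averageL2 K v)‖ ≤ B * (‖u‖ * ‖v‖) := by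
  have hB0 : 0 ≤ B := (norm_nonneg _).trans (hB 0)
  have hd : DenseRange (SchwartzMap.toLpCLM ℝ (E := E) ℂ 2 volume) :=
    SchwartzMap.denseRange_toLpCLM ENNReal.ofNat_ne_top
  refine hd.induction_on (p := fun u => ‖inner ℂ u (averageL2 K v)‖ ≤ B * (‖u‖ * ‖v‖)) u
    (isClosed_le (by fun_prop) (by fun_prop)) fun g => ?_
  refine hd.induction_on (p := fun v => ‖inner ℂ (SchwartzMap.toLpCLM ℝ (E := E) ℂ 2 volume g)
    (averageL2 K v)‖ ≤ B * (‖SchwartzMap.toLpCLM ℝ (E := E) ℂ 2 volume g‖ * ‖v‖)) v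
    (isClosed_le ?_ (by fun_prop)) fun f => ?_
  · have := continuous_averageL2 hK
    fun_prop
  simp only [SchwartzMap.toLpCLM_apply]
  rw [inner_averageL2 hK, integral_inner_translateL2_schwartz hK]
  have hmem : ∀ f : SchwartzMap E ℂ, MemLp (fun x => ‖f x‖) (ENNReal.ofReal 2) volume := fun f => by
    simpa using (f.memLp 2 volume).norm
  have hnorm : ∀ f : SchwartzMap E ℂ,
      (∫ ξ, ‖𝓕 f ξ‖ ^ (2 : ℝ)) ^ (1 / (2 : ℝ)) = ‖f.toLp 2 volume‖ := fun f => by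
    rw [← SchwartzMap.norm_fourier_toL2_eq]
    simp only [SchwartzMap.norm_toLp]
    rw [MemLp.eLpNorm_eq_integral_rpow_norm (by simp) (by simp) ((𝓕 f).memLp 2),
      ENNReal.toReal_ofReal (by positivity)]
    simp
  have hInt : Integrable (fun ξ => ‖𝓕 g ξ‖ * ‖𝓕 f ξ‖) :=
    MemLp.integrable_mul (p := 2) (q := 2) ((𝓕 g).memLp 2 volume).norm ((𝓕 f).memLp 2 volume).norm
  calc ‖∫ ξ, 𝓕 (fun y => (K y : ℂ)) ξ * inner ℂ (𝓕 g ξ) (𝓕 f ξ)‖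
      ≤ ∫ ξ, B * (‖𝓕 g ξ‖ * ‖𝓕 f ξ‖) := by
        refine norm_integral_le_of_norm_le (hInt.const_mul B)
          (Filter.Eventually.of_forall fun ξ => ?_)
        rw [norm_mul]
        exact mul_le_mul (hB ξ) (norm_inner_le_norm _ _) (norm_nonneg _) hB0
    _ = B * ∫ ξ, ‖𝓕 g ξ‖ * ‖𝓕 f ξ‖ := integral_const_mul _ _
    _ ≤ B * (‖g.toLp 2 volume‖ * ‖f.toLp 2 volume‖) := by
        refine mul_le_mul_of_nonneg_left ?_ hB0
        rw [← hnorm g, ← hnorm f]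
        exact integral_mul_le_Lp_mul_Lq_of_nonneg (by constructor <;> norm_num)
          (Filter.Eventually.of_forall fun _ => norm_nonneg _)
          (Filter.Eventually.of_forall fun _ => norm_nonneg _) (hmem (𝓕 g)) (hmem (𝓕 f))

theorem norm_convolution_le {K f : E → ℝ} (hK : Integrable K) {M : ℝ} (hM : ∀ x, ‖f x‖ ≤ M)
    (x : E) : ‖(K ⋆ f) x‖ ≤ (∫ y, ‖K y‖) * M := by
  rw [convolution_real_apply, ← integral_mul_const]
  refine norm_integral_le_of_norm_le (hK.norm.mul_const _) (Filter.Eventually.of_forall fun y => ?_)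
  rw [norm_mul]
  gcongr
  exact hM _

theorem memLp_of_integrable_of_norm_le {f : E → ℝ} (hf : Integrable f) {M : ℝ}
    (hM : ∀ x, ‖f x‖ ≤ M) {p : ℝ} (hp : 1 ≤ p) : MemLp f (ENNReal.ofReal p) volume := by
  have hp0 : 0 < p := by linarith
  refine (integrable_norm_rpow_iff hf.aestronglyMeasurable (by simpa using hp0) (by simp)).mp ?_
  rw [ENNReal.toReal_ofReal hp0.le]
  refine (hf.norm.const_mul (M ^ (p - 1))).mono'
    (hf.aestronglyMeasurable.norm.aemeasurable.pow_const p).aestronglyMeasurable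
    (Filter.Eventually.of_forall fun x => ?_)
  rw [Real.norm_of_nonneg (by positivity)]
  calc ‖f x‖ ^ p = ‖f x‖ ^ (p - 1) * ‖f x‖ := by
        rcases (norm_nonneg (f x)).eq_or_lt with h | h
        · rw [← h, Real.zero_rpow hp0.ne', mul_zero]
        · rw [← Real.rpow_add_one h.ne', sub_add_cancel]
    _ ≤ M ^ (p - 1) * ‖f x‖ := by
        exact mul_le_mul_of_nonneg_right
          (Real.rpow_le_rpow (norm_nonneg _) (hM x) (by linarith)) (norm_nonneg _)

/-- Convolution with an integrable kernel whose Fourier transform is bounded by `B` has `L²` norm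
at most `B`. -/
theorem eLpNorm_two_convolution_le {K f : E → ℝ} (hK : Integrable K) {B : ℝ}
    (hB : ∀ ξ, ‖𝓕 (fun y => (K y : ℂ)) ξ‖ ≤ B) (hf : Integrable f) {M : ℝ}
    (hM : ∀ x, ‖f x‖ ≤ M) :
    eLpNorm (K ⋆ f) 2 volume ≤ ENNReal.ofReal B * eLpNorm f 2 volume := by
  have hB0 : 0 ≤ B := (norm_nonneg _).trans (hB 0)
  have hKf : Integrable (K ⋆ f) := hK.integrable_convolution _ hf
  have mf : MemLp f 2 volume := by
    simpa using memLp_of_integrable_of_norm_le hf hM one_le_two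
  have mKf : MemLp (K ⋆ f) 2 volume := by
    simpa using memLp_of_integrable_of_norm_le hKf (norm_convolution_le hK hM) one_le_two
  set u : Lp ℂ 2 (volume : Measure E) := (mKf.ofReal (K := ℂ)).toLp _ with hu
  set v : Lp ℂ 2 (volume : Measure E) := (mf.ofReal (K := ℂ)).toLp _ with hv
  have nu : ‖u‖ = (eLpNorm (K ⋆ f) 2 volume).toReal := by
    rw [hu, Lp.norm_toLp]
    congr 1
    exact eLpNorm_congr_norm_ae (Filter.Eventually.of_forall fun x => by simp)
  have nv : ‖v‖ = (eLpNorm f 2 volume).toReal := by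
    rw [hv, Lp.norm_toLp]
    congr 1
    exact eLpNorm_congr_norm_ae (Filter.Eventually.of_forall fun x => by simp)
  have key : inner ℂ u (averageL2 K v) = inner ℂ u u := by
    rw [inner_averageL2 hK]
    have h1 : ∀ y, inner ℂ u (translateL2 y v) = ((∫ x, (K ⋆ f) x * f (x - y) : ℝ) : ℂ) := by
      intro y
      have : translateL2 y v =
          MemLp.toLp _ ((mf.ofReal (K := ℂ)).comp_measurePreserving
            (measurePreserving_sub_right volume y)) :=
        Lp.toLp_compMeasurePreserving _ _
      rw [this, L2.inner_def, ← integral_complex_ofReal]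
      refine integral_congr_ae ?_
      filter_upwards [MemLp.coeFn_toLp (mKf.ofReal (K := ℂ)),
        MemLp.coeFn_toLp ((mf.ofReal (K := ℂ)).comp_measurePreserving
            (measurePreserving_sub_right volume y))] with x h1 h2
      rw [h1, h2]
      simp [mul_comm]
    have h2 : inner ℂ u u = ((∫ x, (K ⋆ f) x * (K ⋆ f) x : ℝ) : ℂ) := by
      rw [L2.inner_def, ← integral_complex_ofReal]
      refine integral_congr_ae ?_
      filter_upwards [MemLp.coeFn_toLp (mKf.ofReal (K := ℂ))] with x h1
      rw [h1, RCLike.inner_apply, Complex.ofReal_mul]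
      congr 1
      exact Complex.conj_ofReal _
    simp_rw [h1, h2, ← Complex.ofReal_mul]
    rw [integral_complex_ofReal]
    congr 1
    have hprod : Integrable (Function.uncurry fun y x => K y * ((K ⋆ f) x * f (x - y)))
        (volume.prod volume) := by
      have h0 := (hK.convolution_integrand (ContinuousLinearMap.lsmul ℝ ℝ) hf).swap
      refine Integrable.congr (h0.bdd_mul (c := (∫ y, ‖K y‖) * M)
        (f := fun p : E × E => (K ⋆ f) p.2) ?_ ?_) ?_
      · exact hKf.aestronglyMeasurable.comp_snd
      · exact Filter.Eventually.of_forall fun p => norm_convolution_le hK hM _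
      · refine Filter.Eventually.of_forall fun p => ?_
        simp [Function.uncurry]
        ring
    simp_rw [← integral_const_mul]
    rw [integral_integral_swap hprod]
    refine integral_congr_ae (Filter.Eventually.of_forall fun x => ?_)
    simp only
    conv_rhs => rw [convolution_real_apply K f x, ← integral_const_mul]
    rw [convolution_real_apply]
    refine integral_congr_ae (Filter.Eventually.of_forall fun y => ?_)
    simp only
    ring
  have h3 := norm_inner_averageL2_le hK hB u v
  rw [key, inner_self_eq_norm_sq_to_K] at h3
  have h4 : ‖u‖ ≤ B * ‖v‖ := by
    rcases (norm_nonneg u).eq_or_lt with h | h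
    · rw [← h]; positivity
    · simp at h3
      nlinarith
  rw [nu, nv] at h4
  rw [← ENNReal.ofReal_toReal mKf.eLpNorm_ne_top, ← ENNReal.ofReal_toReal mf.eLpNorm_ne_top,
    ← ENNReal.ofReal_mul hB0]
  exact ENNReal.ofReal_le_ofReal h4

end ConvolutionL2

section CalderonZygmundDecomposition

open Metric Set Module

variable {E : Type*} [NormedAddCommGroup E] [InnerProductSpace ℝ E] [FiniteDimensional ℝ E]
  [MeasurableSpace E] [BorelSpace E]

/-- A mean-zero function supported in a ball is mapped by convolution with a kernel satisfying
Hörmander's condition to a function which is integrable away from the double ball. -/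
theorem lintegral_convolution_compl_closedBall_le {K b : E → ℝ} {β : ℝ≥0∞} (hKm : Measurable K)
    (hK : Integrable K)
    (hH : ∀ v : E, ∫⁻ y in {y | 2 * ‖v‖ < ‖y‖}, ‖K (y - v) - K y‖ₑ ≤ β)
    (hbm : Measurable b) (hb : Integrable b) (h0 : ∫ x, b x = 0) {c : E} {ρ : ℝ}
    (hsupp : ∀ x, x ∉ closedBall c ρ → b x = 0) :
    ∫⁻ x in (closedBall c (2 * ρ))ᶜ, ‖(K ⋆ b) x‖ₑ ≤ β * ∫⁻ x, ‖b x‖ₑ := by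
  have hae : ∀ᵐ x : E, ‖(K ⋆ b) x‖ₑ ≤ ∫⁻ w, ‖K (x - w) - K (x - c)‖ₑ * ‖b w‖ₑ := by
    filter_upwards [hK.ae_convolution_exists (ContinuousLinearMap.lsmul ℝ ℝ) hb] with x hx
    have hx' : Integrable fun w => K (x - w) * b w := by
      simpa using hx.integrable_swap
    have : (K ⋆ b) x = ∫ w, (K (x - w) - K (x - c)) * b w := by
      simp_rw [sub_mul]
      rw [convolution_real_apply_swap, integral_sub hx' (hb.const_mul _), integral_const_mul, h0,
        mul_zero, sub_zero]
    rw [this]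
    refine (enorm_integral_le_lintegral_enorm _).trans (le_of_eq ?_)
    simp_rw [enorm_mul]
  calc ∫⁻ x in (closedBall c (2 * ρ))ᶜ, ‖(K ⋆ b) x‖ₑ
      ≤ ∫⁻ x in (closedBall c (2 * ρ))ᶜ, ∫⁻ w, ‖K (x - w) - K (x - c)‖ₑ * ‖b w‖ₑ :=
        lintegral_mono_ae (ae_restrict_of_ae hae)
    _ = ∫⁻ w, ∫⁻ x in (closedBall c (2 * ρ))ᶜ, ‖K (x - w) - K (x - c)‖ₑ * ‖b w‖ₑ := by
        refine lintegral_lintegral_swap (Measurable.aemeasurable ?_)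
        simp only [Function.uncurry_def]
        fun_prop
    _ ≤ ∫⁻ w, β * ‖b w‖ₑ := by
        refine lintegral_mono fun w => ?_
        by_cases hw : w ∈ closedBall c ρ
        · rw [lintegral_mul_const _ (by fun_prop)]
          gcongr
          refine le_trans ?_ (hH (w - c))
          have hmp := (measurePreserving_sub_right (volume : Measure E) c).setLIntegral_comp_preimage
            (s := {y | 2 * ‖w - c‖ < ‖y‖}) (measurableSet_lt measurable_const measurable_norm)
            (f := fun y => ‖K (y - (w - c)) - K y‖ₑ) (by fun_prop)
          rw [← hmp]
          simp only [sub_sub_sub_cancel_right]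
          refine lintegral_mono_set fun x hx => ?_
          simp only [mem_compl_iff, mem_closedBall, not_le, dist_eq_norm] at hx hw
          simp only [preimage_ofPred_eq, mem_ofPred_eq]
          linarith
        · simp [hsupp w hw]
    _ = β * ∫⁻ x, ‖b x‖ₑ := lintegral_const_mul _ (by fun_prop)

theorem volume_closedBall_mul (c : E) {t r : ℝ} (ht : 0 ≤ t) (hr : 0 ≤ r) :
    volume (closedBall c (t * r)) = ENNReal.ofReal t ^ finrank ℝ E * volume (closedBall c r) := by
  rw [Measure.addHaar_closedBall _ _ (mul_nonneg ht hr), Measure.addHaar_closedBall _ _ hr, mul_pow,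
    ENNReal.ofReal_mul (by positivity), ENNReal.ofReal_pow ht, mul_assoc]

/-- Calderón–Zygmund covering of the set where the averages of `|f|` exceed `l`. -/
theorem exists_calderonZygmund_balls [Nontrivial E] {f : E → ℝ} (hc : Continuous f)
    (hf : Integrable f) {l : ℝ} (hl : 0 < l) :
    ∃ (u : Set E) (r : E → ℝ), u.Countable ∧ (∀ c ∈ u, 0 < r c) ∧
      u.PairwiseDisjoint (fun c => closedBall c (r c)) ∧
      (∀ c ∈ u, ENNReal.ofReal l * volume (closedBall c (r c)) ≤
        ∫⁻ x in closedBall c (r c), ‖f x‖ₑ) ∧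
      (∀ c ∈ u, ∫⁻ x in closedBall c (5 * r c), ‖f x‖ₑ ≤
        ENNReal.ofReal l * volume (closedBall c (5 * r c))) ∧
      ∀ x, (∀ c ∈ u, x ∉ closedBall c (5 * r c)) → ‖f x‖ ≤ l := by
  set P : E → ℝ → Prop := fun x ρ =>
    0 < ρ ∧ ENNReal.ofReal l * volume (closedBall x ρ) < ∫⁻ y in closedBall x ρ, ‖f y‖ₑ with hP
  have hn : finrank ℝ E ≠ 0 := finrank_pos.ne'
  obtain ⟨R, hR⟩ : ∃ R : ℝ, ∀ x ρ, P x ρ → ρ ≤ R := by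
    set v := volume.real (ball (0 : E) 1)
    have hv : 0 < v := ENNReal.toReal_pos (measure_ball_pos _ _ one_pos).ne' measure_ball_lt_top.ne
    refine ⟨max 1 ((∫ y, ‖f y‖) / (l * v)), fun x ρ ⟨hρ, h⟩ => ?_⟩
    by_contra! hcon
    rw [max_lt_iff] at hcon
    have h1 : ENNReal.ofReal l * volume (closedBall x ρ) < ENNReal.ofReal (∫ y, ‖f y‖) := by
      refine h.trans_le ((setLIntegral_le_lintegral _ _).trans ?_)
      rw [ofReal_integral_norm_eq_lintegral_enorm hf]
    rw [Measure.addHaar_closedBall _ _ hρ.le, ← ENNReal.ofReal_toReal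
      (measure_ball_lt_top (μ := volume) (x := (0 : E)) (r := 1)).ne,
      ← ENNReal.ofReal_mul (by positivity), ← ENNReal.ofReal_mul hl.le,
      ENNReal.ofReal_lt_ofReal_iff_of_nonneg (by positivity)] at h1
    have h2 : ρ ≤ ρ ^ finrank ℝ E := le_self_pow₀ hcon.1.le hn
    have h3 := hcon.2
    rw [div_lt_iff₀ (by positivity)] at h3
    have h4 : ρ * v ≤ ρ ^ finrank ℝ E * v := by gcongr
    have h5 : l * (ρ * v) ≤ l * (ρ ^ finrank ℝ E * v) := by gcongr
    have h6 : l * (ρ ^ finrank ℝ E * v) < ∫ y, ‖f y‖ := h1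
    linarith
  have hex : ∀ x, (∃ ρ, P x ρ) → ∃ ρ, P x ρ ∧ ¬ P x (5 * ρ) := by
    rintro x ⟨ρ, hρ⟩
    have hbdd : BddAbove {ρ | P x ρ} := ⟨R, fun ρ h => hR x ρ h⟩
    have hpos : 0 < sSup {ρ | P x ρ} := hρ.1.trans_le (le_csSup hbdd hρ)
    obtain ⟨ρ', h1, h2⟩ := exists_lt_of_lt_csSup ⟨ρ, hρ⟩
      (show sSup {ρ | P x ρ} / 5 < sSup {ρ | P x ρ} by linarith)
    refine ⟨ρ', h1, fun h => ?_⟩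
    have := le_csSup hbdd h
    linarith
  choose! r hr using hex
  obtain ⟨u, hu, hdisj, hcov⟩ := Vitali.exists_disjoint_subfamily_covering_enlargement_closedBall
    {x | ∃ ρ, P x ρ} (fun x => x) r R (fun x hx => hR x _ (hr x hx).1) 5 (by norm_num)
  refine ⟨u, r, ?_, fun c hc => (hr c (hu hc)).1.1, hdisj, fun c hc => (hr c (hu hc)).1.2.le,
    fun c hc => ?_, fun x hx => ?_⟩
  · refine hdisj.countable_of_nonempty_interior fun c hc => ?_
    exact ⟨c, ball_subset_interior_closedBall (mem_ball_self (hr c (hu hc)).1.1)⟩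
  · have := (hr c (hu hc)).2
    simp only [hP, not_and, not_lt] at this
    exact this (by linarith [(hr c (hu hc)).1.1])
  · have hnot : ∀ ρ, ¬ P x ρ := by
      intro ρ hρ
      obtain ⟨c, hcu, hsub⟩ := hcov x ⟨ρ, hρ⟩
      exact hx c hcu (hsub (mem_closedBall_self (hr x ⟨ρ, hρ⟩).1.1.le))
    by_contra! hlt
    set m := (l + ‖f x‖) / 2 with hm
    have hev : ∀ᶠ y in nhds x, m < ‖f y‖ :=
      hc.norm.continuousAt.eventually (lt_mem_nhds (by linarith))
    obtain ⟨ρ, hρ, hsub⟩ := Metric.nhds_basis_closedBall.mem_iff.mp hev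
    refine hnot ρ ⟨hρ, ?_⟩
    have hv0 : volume (closedBall x ρ) ≠ 0 := (measure_closedBall_pos _ _ hρ).ne'
    have hvt : volume (closedBall x ρ) ≠ ⊤ := measure_closedBall_lt_top.ne
    calc ENNReal.ofReal l * volume (closedBall x ρ)
        < ENNReal.ofReal m * volume (closedBall x ρ) := by
          refine ENNReal.mul_lt_mul_left hv0 hvt ?_
          exact (ENNReal.ofReal_lt_ofReal_iff (by linarith)).mpr (by linarith)
      _ = ∫⁻ y in closedBall x ρ, ENNReal.ofReal m := by rw [setLIntegral_const]
      _ ≤ ∫⁻ y in closedBall x ρ, ‖f y‖ₑ := by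
          refine setLIntegral_mono' measurableSet_closedBall fun y hy => ?_
          rw [← ofReal_norm]
          exact ENNReal.ofReal_le_ofReal (le_of_lt (hsub hy))

theorem summable_indicator_of_pairwise_disjoint {ι X : Type*} {s : ι → Set X}
    (hs : Pairwise (Function.onFun Disjoint s)) (h : ι → X → ℝ) (x : X) :
    Summable fun i => (s i).indicator (h i) x := by
  refine summable_of_hasFiniteSupport (Set.Subsingleton.finite fun i hi j hj => ?_)
  by_contra hij
  exact (hs hij).ne_of_mem (mem_of_indicator_ne_zero hi) (mem_of_indicator_ne_zero hj) rfl

theorem tsum_indicator_of_mem {ι X : Type*} {s : ι → Set X}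
    (hs : Pairwise (Function.onFun Disjoint s)) (h : ι → X → ℝ) {x : X} {i : ι} (hx : x ∈ s i) :
    ∑' j, (s j).indicator (h j) x = h i x := by
  rw [tsum_eq_single i, indicator_of_mem hx]
  intro j hj
  exact indicator_of_notMem (fun hxj => (hs hj).ne_of_mem hxj hx rfl) _

theorem tsum_indicator_of_forall_notMem {ι X : Type*} {s : ι → Set X} (h : ι → X → ℝ) {x : X}
    (hx : ∀ i, x ∉ s i) : ∑' j, (s j).indicator (h j) x = 0 := by
  simp [indicator_of_notMem (hx _)]

/-- A countable family of sets can be refined to a pairwise disjoint family with the same union. -/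
theorem exists_pairwise_disjoint_refinement {ι X : Type*} [MeasurableSpace X] [Countable ι]
    (W : ι → Set X)
    (hW : ∀ i, MeasurableSet (W i)) :
    ∃ s : ι → Set X, (∀ i, MeasurableSet (s i)) ∧ (∀ i, s i ⊆ W i) ∧
      Pairwise (Function.onFun Disjoint s) ∧ ⋃ i, s i = ⋃ i, W i := by
  obtain ⟨e, he⟩ := exists_injective_nat ι
  refine ⟨fun i => W i \ ⋃ j ∈ {j | e j < e i}, W j, fun i => ?_, fun i => sdiff_subset, ?_, ?_⟩
  · exact (hW i).diff (MeasurableSet.biUnion (to_countable _) fun j _ => hW j)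
  · intro i j hij
    rw [Function.onFun, Set.disjoint_left]
    rintro x ⟨hxi, hxi'⟩ ⟨hxj, hxj'⟩
    simp only [mem_ofPred_eq, mem_iUnion, not_exists] at hxi' hxj'
    rcases lt_trichotomy (e i) (e j) with h | h | h
    · exact hxj' i h hxi
    · exact hij (he h)
    · exact hxi' j h hxj
  · refine subset_antisymm (iUnion_mono fun i => sdiff_subset) fun x hx => ?_
    have hne : ({n | ∃ i, e i = n ∧ x ∈ W i} : Set ℕ).Nonempty := by
      obtain ⟨i, hi⟩ := mem_iUnion.mp hx
      exact ⟨e i, i, rfl, hi⟩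
    obtain ⟨i, hi, hxi⟩ := Nat.sInf_mem hne
    refine mem_iUnion.mpr ⟨i, hxi, ?_⟩
    simp only [mem_ofPred_eq, mem_iUnion, not_exists]
    intro j hj hxj
    have : sInf {n | ∃ i, e i = n ∧ x ∈ W i} ≤ e j := Nat.sInf_le ⟨j, rfl, hxj⟩
    omega

end CalderonZygmundDecomposition

section CalderonZygmundGoodBad

open Metric Set Module

variable {E : Type*} [NormedAddCommGroup E] [InnerProductSpace ℝ E] [FiniteDimensional ℝ E]
  [MeasurableSpace E] [BorelSpace E]

theorem measurable_tsum_indicator {ι X : Type*} [MeasurableSpace X] [Countable ι] {s : ι → Set X}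
    (hsm : ∀ i, MeasurableSet (s i)) (hs : Pairwise (Function.onFun Disjoint s)) {h : ι → X → ℝ}
    (hh : ∀ i, Measurable (h i)) : Measurable fun x => ∑' i, (s i).indicator (h i) x := by
  refine measurable_of_tendsto_metrizable' Filter.atTop (f := fun (t : Finset ι) x =>
    ∑ i ∈ t, (s i).indicator (h i) x)
    (fun t => Finset.measurable_fun_sum t fun i _ => (hh i).indicator (hsm i)) ?_
  exact tendsto_pi_nhds.mpr fun x => (summable_indicator_of_pairwise_disjoint hs h x).hasSum

/-- The Calderón–Zygmund decomposition at height `l` of a continuous integrable function `f` into a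
bounded function `g` and mean-zero functions `b i` supported in balls. -/
theorem exists_calderonZygmund_decomposition [Nontrivial E] {f : E → ℝ} (hc : Continuous f)
    (hf : Integrable f) {l : ℝ} (hl : 0 < l) :
    ∃ (u : Set E) (r : E → ℝ) (g : E → ℝ) (b : u → E → ℝ), u.Countable ∧ Measurable g ∧
      Integrable g ∧ (∀ x, ‖g x‖ ≤ 5 ^ finrank ℝ E * l) ∧
      (∫⁻ x, ‖g x‖ₑ ^ 2 ≤ (∫⁻ x in {x | ‖f x‖ ≤ l}, ‖f x‖ₑ ^ 2) +
        (5 ^ finrank ℝ E * ENNReal.ofReal l) ^ 2 * ∑' c : u, volume (closedBall (c : E) (r c))) ∧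
      (∀ c, Measurable (b c)) ∧ (∀ c, Integrable (b c)) ∧ (∀ c, ∫ x, b c x = 0) ∧
      (∀ c : u, ∀ x, x ∉ closedBall (c : E) (5 * r c) → b c x = 0) ∧
      (∀ c : u, 0 < r c) ∧
      (∀ c : u, ∫⁻ x, ‖b c x‖ₑ ≤
        2 * (5 ^ finrank ℝ E * ENNReal.ofReal l) * volume (closedBall (c : E) (r c))) ∧
      (∀ x, f x = g x + ∑' c, b c x) ∧
      ENNReal.ofReal l * ∑' c : u, volume (closedBall (c : E) (r c)) ≤
        2 * ∫⁻ x in {x | l / 2 < ‖f x‖}, ‖f x‖ₑ := by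
  obtain ⟨u, r, hu, hr, hdisj, hlow, hup, hbd⟩ := exists_calderonZygmund_balls hc hf hl
  have : Countable u := hu.to_subtype
  set n := finrank ℝ E
  set a := ENNReal.ofReal l with ha
  have ha0 : a ≠ 0 := by simpa [ha] using hl
  have hat : a ≠ ⊤ := ENNReal.ofReal_ne_top
  set B : u → Set E := fun c => closedBall (c : E) (r c) with hBdef
  set W : u → Set E := fun c => closedBall (c : E) (5 * r c) with hWdef
  have hBm : ∀ c, MeasurableSet (B c) := fun c => measurableSet_closedBall
  have hBd : Pairwise (Function.onFun Disjoint B) := fun c c' hcc =>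
    hdisj c.2 c'.2 (fun h => hcc (Subtype.ext h))
  have hBW : ∀ c, B c ⊆ W c := fun c =>
    closedBall_subset_closedBall (by linarith [hr c c.2])
  have hB0 : ∀ c, volume (B c) ≠ 0 := fun c => (measure_closedBall_pos _ _ (hr c c.2)).ne'
  have hBt : ∀ c, volume (B c) ≠ ⊤ := fun c => measure_closedBall_lt_top.ne
  have hWv : ∀ c, volume (W c) = 5 ^ n * volume (B c) := fun c => by
    have := volume_closedBall_mul (c : E) (t := 5) (r := r c) (by norm_num) (hr c c.2).le
    simpa using this
  obtain ⟨s, hsm, hsW, hsd, hsU⟩ := exists_pairwise_disjoint_refinement W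
    fun c => measurableSet_closedBall
  have hsf : ∀ c, ∫⁻ x in s c, ‖f x‖ₑ ≤ 5 ^ n * a * volume (B c) := fun c => by
    refine (lintegral_mono_set (hsW c)).trans ((hup c c.2).trans (le_of_eq ?_))
    change a * volume (W c) = _
    rw [hWv]
    ring
  set κ : u → ℝ := fun c => (∫ x in s c, f x) / volume.real (B c) with hκ
  have hvpos : ∀ c, 0 < volume.real (B c) := fun c => ENNReal.toReal_pos (hB0 c) (hBt c)
  have hκe : ∀ c, ‖κ c‖ₑ * volume (B c) ≤ ∫⁻ x in s c, ‖f x‖ₑ := fun c => by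
    refine le_trans (le_of_eq ?_) (enorm_integral_le_lintegral_enorm _)
    have : ∫ x in s c, f x = κ c * volume.real (B c) := by
      rw [hκ, div_mul_cancel₀ _ (hvpos c).ne']
    rw [this, enorm_mul]
    congr 1
    rw [Real.enorm_eq_ofReal (hvpos c).le, Measure.real, ENNReal.ofReal_toReal (hBt c)]
  have hκb : ∀ c, ‖κ c‖ₑ ≤ 5 ^ n * a := fun c => by
    have := (hκe c).trans (hsf c)
    rwa [ENNReal.mul_le_mul_iff_left (hB0 c) (hBt c)] at this
  set g : E → ℝ := fun x => (⋃ c, W c)ᶜ.indicator f x + ∑' c, (B c).indicator (fun _ => κ c) x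
    with hg
  set b : u → E → ℝ := fun c x => (s c).indicator f x - (B c).indicator (fun _ => κ c) x with hb
  have hsumB : a * ∑' c, volume (B c) ≤ 2 * ∫⁻ x in {x | l / 2 < ‖f x‖}, ‖f x‖ₑ := by
    have hT : MeasurableSet {x | l / 2 < ‖f x‖} :=
      measurableSet_lt measurable_const hc.measurable.norm
    have hhalf : ∀ c, a * volume (B c) ≤
        2 * ∫⁻ x in B c, {x | l / 2 < ‖f x‖}.indicator (fun x => ‖f x‖ₑ) x := fun c => by
      have h1 : a * volume (B c) ≤ (∫⁻ x in B c, {x | l / 2 < ‖f x‖}.indicator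
          (fun x => ‖f x‖ₑ) x) + a / 2 * volume (B c) := by
        refine (hlow c c.2).trans ?_
        rw [← setLIntegral_const, ← lintegral_add_right _ measurable_const]
        refine lintegral_mono fun x => ?_
        by_cases hx : l / 2 < ‖f x‖
        · rw [indicator_of_mem (show x ∈ {x | l / 2 < ‖f x‖} from hx)]
          exact le_self_add
        · refine le_trans ?_ le_add_self
          rw [← ofReal_norm, ha, ← ENNReal.ofReal_ofNat, ← ENNReal.ofReal_div_of_pos two_pos]
          exact ENNReal.ofReal_le_ofReal (not_lt.mp hx)
      have h2 : a * volume (B c) = a / 2 * volume (B c) + a / 2 * volume (B c) := by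
        rw [← add_mul, ENNReal.add_halves]
      have h3 : a / 2 * volume (B c) ≠ ⊤ :=
        ENNReal.mul_ne_top (ENNReal.div_ne_top hat two_ne_zero) (hBt c)
      rw [h2, ENNReal.add_le_add_iff_right h3] at h1
      rw [h2, ← two_mul]
      gcongr
    calc a * ∑' c, volume (B c) = ∑' c, a * volume (B c) := ENNReal.tsum_mul_left.symm
      _ ≤ ∑' c, 2 * ∫⁻ x in B c, {x | l / 2 < ‖f x‖}.indicator (fun x => ‖f x‖ₑ) x :=
        ENNReal.tsum_le_tsum hhalf
      _ = 2 * ∫⁻ x in ⋃ c, B c, {x | l / 2 < ‖f x‖}.indicator (fun x => ‖f x‖ₑ) x := by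
        rw [ENNReal.tsum_mul_left, lintegral_iUnion hBm hBd]
      _ ≤ 2 * ∫⁻ x, {x | l / 2 < ‖f x‖}.indicator (fun x => ‖f x‖ₑ) x := by
        gcongr
        exact Measure.restrict_le_self
      _ = _ := by rw [lintegral_indicator hT]
  have hsumt : ∑' c, volume (B c) ≠ ⊤ := by
    intro htop
    rw [htop, ENNReal.mul_top ha0, top_le_iff] at hsumB
    refine ENNReal.mul_ne_top ENNReal.ofNat_ne_top ?_ hsumB
    exact ((setLIntegral_le_lintegral _ _).trans_lt hf.2).ne
  have hgm : Measurable g :=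
    (hc.measurable.indicator (MeasurableSet.iUnion fun c => measurableSet_closedBall).compl).add
      (measurable_tsum_indicator hBm hBd fun c => measurable_const)
  have hgB : ∀ c, ∀ x ∈ B c, g x = κ c := fun c x hx => by
    simp only [hg]
    rw [indicator_of_notMem (by simpa using ⟨c, c.2, hBW c hx⟩), zero_add,
      tsum_indicator_of_mem hBd _ hx]
  have hgn : ∀ x, (∀ c, x ∉ B c) → g x = (⋃ c, W c)ᶜ.indicator f x := fun x hx => by
    simp only [hg]
    rw [tsum_indicator_of_forall_notMem _ hx, add_zero]
  have hsmall : ∀ x, x ∈ (⋃ c, W c)ᶜ → ‖f x‖ ≤ l := fun x hx => by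
    refine hbd x fun c hcu hxc => hx (mem_iUnion.mpr ⟨⟨c, hcu⟩, hxc⟩)
  have hgp : ∀ (p : ℕ) x, ‖g x‖ₑ ^ (p + 1) ≤
      {x | ‖f x‖ ≤ l}.indicator (fun x => ‖f x‖ₑ ^ (p + 1)) x +
      ∑' c, (B c).indicator (fun _ => (5 ^ n * a) ^ (p + 1)) x := fun p x => by
    by_cases hx : ∃ c, x ∈ B c
    · obtain ⟨c, hxc⟩ := hx
      rw [hgB c x hxc]
      refine le_trans ?_ le_add_self
      refine le_trans ?_ (ENNReal.le_tsum c)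
      rw [indicator_of_mem hxc]
      gcongr
      exact hκb c
    · push Not at hx
      rw [hgn x hx]
      refine le_trans ?_ le_self_add
      by_cases hxW : x ∈ (⋃ c, W c)ᶜ
      · rw [indicator_of_mem hxW, indicator_of_mem (show x ∈ {x | ‖f x‖ ≤ l} from hsmall x hxW)]
      · rw [indicator_of_notMem hxW, enorm_zero, zero_pow p.succ_ne_zero]
        exact zero_le
  have hlp : ∀ p : ℕ, ∫⁻ x, ‖g x‖ₑ ^ (p + 1) ≤ (∫⁻ x in {x | ‖f x‖ ≤ l}, ‖f x‖ₑ ^ (p + 1)) +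
      (5 ^ n * a) ^ (p + 1) * ∑' c, volume (B c) := fun p => by
    refine (lintegral_mono (hgp p)).trans (le_of_eq ?_)
    rw [lintegral_add_right _ (Measurable.tsum fun c =>
      measurable_const.indicator (hBm c)), lintegral_indicator
      (measurableSet_le hc.measurable.norm measurable_const), lintegral_tsum
      (fun c => (measurable_const.indicator (hBm c)).aemeasurable), ← ENNReal.tsum_mul_left]
    congr 1
    refine tsum_congr fun c => ?_
    rw [lintegral_indicator_const (hBm c)]
  have hbi : ∀ c, Integrable (b c) := fun c =>
    (hf.indicator (hsm c)).sub ((integrable_indicator_iff (hBm c)).mpr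
      (integrableOn_const (hBt c)))
  refine ⟨u, r, g, b, hu, hgm, ⟨hgm.aestronglyMeasurable, ?_⟩, fun x => ?_, hlp 1, fun c => ?_, hbi,
    fun c => ?_, fun c x hx => ?_, fun c => hr c c.2, fun c => ?_, fun x => ?_, hsumB⟩
  · have := hlp 0
    simp only [zero_add, pow_one] at this
    refine this.trans_lt (ENNReal.add_lt_top.mpr ⟨(setLIntegral_le_lintegral _ _).trans_lt hf.2, ?_⟩)
    exact (ENNReal.mul_ne_top (ENNReal.mul_ne_top (by simp) hat) hsumt).lt_top
  · by_cases hx : ∃ c, x ∈ B c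
    · obtain ⟨c, hxc⟩ := hx
      rw [hgB c x hxc]
      have := hκb c
      rw [← ofReal_norm, ha, ← ENNReal.ofReal_ofNat, ← ENNReal.ofReal_pow (by norm_num),
        ← ENNReal.ofReal_mul (by positivity), ENNReal.ofReal_le_ofReal_iff (by positivity)] at this
      exact this
    · push Not at hx
      rw [hgn x hx]
      have h1 : l ≤ 5 ^ n * l := le_mul_of_one_le_left hl.le (one_le_pow₀ (by norm_num))
      by_cases hxW : x ∈ (⋃ c, W c)ᶜ
      · rw [indicator_of_mem hxW]
        exact (hsmall x hxW).trans h1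
      · rw [indicator_of_notMem hxW, norm_zero]
        positivity
  · exact (hc.measurable.indicator (hsm c)).sub (measurable_const.indicator (hBm c))
  · rw [integral_sub (hf.indicator (hsm c)) ((integrable_indicator_iff (hBm c)).mpr
      (integrableOn_const (hBt c))), integral_indicator (hsm c), integral_indicator (hBm c),
      setIntegral_const, smul_eq_mul, hκ]
    field_simp [(hvpos c).ne']
    simp
  · simp only [hb]
    rw [indicator_of_notMem fun h => hx (hsW c h), indicator_of_notMem fun h => hx (hBW c h),
      sub_zero]
  · calc ∫⁻ x, ‖b c x‖ₑ
        ≤ ∫⁻ x, ((s c).indicator (fun x => ‖f x‖ₑ) x + (B c).indicator (fun _ => ‖κ c‖ₑ) x) := by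
          refine lintegral_mono fun x => ?_
          refine enorm_sub_le.trans (le_of_eq ?_)
          rw [enorm_indicator_eq_indicator_enorm, enorm_indicator_eq_indicator_enorm]
      _ = (∫⁻ x in s c, ‖f x‖ₑ) + ‖κ c‖ₑ * volume (B c) := by
          rw [lintegral_add_right _ (measurable_const.indicator (hBm c)),
            lintegral_indicator (hsm c), lintegral_indicator_const (hBm c)]
      _ ≤ 5 ^ n * a * volume (B c) + 5 ^ n * a * volume (B c) :=
          add_le_add (hsf c) ((hκe c).trans (hsf c))
      _ = _ := by ring
  · have hsub : ∑' c, b c x = ∑' c, (s c).indicator f x - ∑' c, (B c).indicator (fun _ => κ c) x :=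
      (summable_indicator_of_pairwise_disjoint hsd (fun _ => f) x).tsum_sub
        (summable_indicator_of_pairwise_disjoint hBd (fun c _ => κ c) x)
    rw [hsub]
    simp only [hg]
    by_cases hx : x ∈ ⋃ c, W c
    · rw [indicator_of_notMem (by simpa using hx)]
      obtain ⟨c, hxc⟩ := mem_iUnion.mp (hsU ▸ hx)
      rw [tsum_indicator_of_mem hsd (fun _ => f) hxc]
      ring
    · rw [indicator_of_mem (show x ∈ (⋃ c, W c)ᶜ from hx), tsum_indicator_of_forall_notMem
        (s := s) (fun _ => f) fun c hxc => hx (mem_iUnion.mpr ⟨c, hsW c hxc⟩)]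
      ring

end CalderonZygmundGoodBad

section LevelSets

open Metric Set Module

variable {E : Type*} [NormedAddCommGroup E] [InnerProductSpace ℝ E] [FiniteDimensional ℝ E]
  [MeasurableSpace E] [BorelSpace E]

theorem lintegral_sq_convolution_le {K f : E → ℝ} (hK : Integrable K) {B : ℝ}
    (hB : ∀ ξ, ‖𝓕 (fun y => (K y : ℂ)) ξ‖ ≤ B) (hf : Integrable f) {M : ℝ}
    (hM : ∀ x, ‖f x‖ ≤ M) :
    ∫⁻ x, ‖(K ⋆ f) x‖ₑ ^ 2 ≤ ENNReal.ofReal B ^ 2 * ∫⁻ x, ‖f x‖ₑ ^ 2 := by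
  have key : ∀ u : E → ℝ, ∫⁻ x, ‖u x‖ₑ ^ 2 = eLpNorm u 2 volume ^ 2 := fun u => by
    have := eLpNorm_nnreal_pow_eq_lintegral (f := u) (μ := volume) (p := 2) two_ne_zero
    simpa using this.symm
  rw [key, key, ← mul_pow]
  gcongr
  exact eLpNorm_two_convolution_le hK hB hf hM

theorem lintegral_lintegral_convolution {K b : E → ℝ} (hKm : Measurable K) (hbm : Measurable b) :
    ∫⁻ x, ∫⁻ y, ‖K (x - y) * b y‖ₑ = (∫⁻ x, ‖K x‖ₑ) * ∫⁻ y, ‖b y‖ₑ := by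
  rw [lintegral_lintegral_swap (Measurable.aemeasurable (by
    simp only [Function.uncurry_def]
    fun_prop))]
  simp_rw [enorm_mul]
  rw [← lintegral_const_mul _ (by fun_prop)]
  refine lintegral_congr fun y => ?_
  rw [lintegral_mul_const _ (by fun_prop), lintegral_sub_right_eq_self (fun x => ‖K x‖ₑ) y]

theorem ae_convolution_add_tsum {ι : Type*} [Countable ι] {K f g : E → ℝ} {b : ι → E → ℝ}
    (hKm : Measurable K) (hK : Integrable K) (hf : Integrable f) (hg : Integrable g)
    (hbm : ∀ i, Measurable (b i)) (hb : ∑' i, ∫⁻ x, ‖b i x‖ₑ ≠ ⊤)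
    (hfg : ∀ x, f x = g x + ∑' i, b i x) :
    ∀ᵐ x : E, (K ⋆ f) x = (K ⋆ g) x + ∑' i, (K ⋆ b i) x := by
  have hfin : ∀ᵐ x : E, ∑' i, ∫⁻ y, ‖K (x - y) * b i y‖ₑ < ⊤ := by
    have hm : ∀ i, Measurable fun x : E => ∫⁻ y, ‖K (x - y) * b i y‖ₑ := fun i => by
      have := hbm i
      exact Measurable.lintegral_prod_right' (f := fun p : E × E => ‖K (p.1 - p.2) * b i p.2‖ₑ)
        (by fun_prop)
    refine ae_lt_top (Measurable.tsum hm) ?_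
    rw [lintegral_tsum fun i => (hm i).aemeasurable]
    simp_rw [lintegral_lintegral_convolution hKm (hbm _)]
    rw [ENNReal.tsum_mul_left]
    exact ENNReal.mul_ne_top hK.2.ne hb
  filter_upwards [hfin, hK.ae_convolution_exists (ContinuousLinearMap.lsmul ℝ ℝ) hf,
    hK.ae_convolution_exists (ContinuousLinearMap.lsmul ℝ ℝ) hg] with x h1 h2 h3
  have h2' : Integrable fun w => K (x - w) * f w := by simpa using h2.integrable_swap
  have h3' : Integrable fun w => K (x - w) * g w := by simpa using h3.integrable_swap
  simp_rw [convolution_real_apply_swap]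
  rw [← integral_tsum (fun i => by have := hbm i; fun_prop) h1.ne, ← sub_eq_iff_eq_add',
    ← integral_sub h2' h3']
  refine integral_congr_ae (Filter.Eventually.of_forall fun y => ?_)
  change K (x - y) * f y - K (x - y) * g y = ∑' i, K (x - y) * b i y
  rw [tsum_mul_left, hfg y]
  ring

/-- A level set estimate for singular integrals, interpolating between the weak `(1,1)` and the
strong `(2,2)` bound. -/
theorem volume_convolution_gt_le [Nontrivial E] {K f : E → ℝ} {B : ℝ} (hKm : Measurable K)
    (hK : Integrable K) (hB : ∀ ξ, ‖𝓕 (fun y => (K y : ℂ)) ξ‖ ≤ B)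
    (hH : ∀ v : E, ∫⁻ y in {y | 2 * ‖v‖ < ‖y‖}, ‖K (y - v) - K y‖ₑ ≤ ENNReal.ofReal B)
    (hc : Continuous f) (hf : Integrable f) {l : ℝ} (hl : 0 < l) :
    volume {x | 2 * l < ‖(K ⋆ f) x‖} ≤
      (ENNReal.ofReal B ^ 2 + 2 * (ENNReal.ofReal B ^ 2 * (5 ^ finrank ℝ E) ^ 2 +
        10 ^ finrank ℝ E + 2 * 5 ^ finrank ℝ E * ENNReal.ofReal B)) *
      ((∫⁻ x in {x | ‖f x‖ ≤ l}, ‖f x‖ₑ ^ 2) / ENNReal.ofReal l ^ 2 +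
        (∫⁻ x in {x | l / 2 < ‖f x‖}, ‖f x‖ₑ) / ENNReal.ofReal l) := by
  obtain ⟨u, r, g, b, hu, hgm, hgi, hgb, hg2, hbm, hbi, hb0, hbs, hr, hb1, hfg, hsum⟩ :=
    exists_calderonZygmund_decomposition hc hf hl
  have : Countable u := hu.to_subtype
  set n := finrank ℝ E
  set a := ENNReal.ofReal l with ha
  set β := ENNReal.ofReal B with hβ
  have ha0 : a ≠ 0 := by simpa [ha] using hl
  have hat : a ≠ ⊤ := ENNReal.ofReal_ne_top
  set V := ∑' c : u, volume (closedBall (c : E) (r c)) with hV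
  set F₂ := ∫⁻ x in {x | ‖f x‖ ≤ l}, ‖f x‖ₑ ^ 2
  set F₁ := ∫⁻ x in {x | l / 2 < ‖f x‖}, ‖f x‖ₑ with hF₁
  have hVF : V ≤ 2 * (F₁ / a) := by
    rw [← mul_div_assoc]
    refine (ENNReal.le_div_iff_mul_le (Or.inl ha0) (Or.inl hat)).mpr ?_
    rwa [mul_comm]
  have hF₁t : F₁ ≠ ⊤ := ((setLIntegral_le_lintegral _ _).trans_lt hf.2).ne
  have hVt : V ≠ ⊤ := ne_top_of_le_ne_top
    (ENNReal.mul_ne_top ENNReal.ofNat_ne_top (ENNReal.div_ne_top hF₁t ha0)) hVF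
  have hsb : ∑' c, ∫⁻ x, ‖b c x‖ₑ ≤ 2 * (5 ^ n * a) * V := by
    rw [hV, ← ENNReal.tsum_mul_left]
    exact ENNReal.tsum_le_tsum hb1
  have hsbt : ∑' c, ∫⁻ x, ‖b c x‖ₑ ≠ ⊤ := ne_top_of_le_ne_top (ENNReal.mul_ne_top
    (ENNReal.mul_ne_top ENNReal.ofNat_ne_top (ENNReal.mul_ne_top (by simp) hat)) hVt) hsb
  set D : Set E := ⋃ c : u, closedBall (c : E) (2 * (5 * r c)) with hD
  have hDm : MeasurableSet D := MeasurableSet.iUnion fun c => measurableSet_closedBall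
  have hDv : volume D ≤ 10 ^ n * V := by
    refine (measure_iUnion_le _).trans (le_of_eq ?_)
    rw [hV, ← ENNReal.tsum_mul_left]
    refine tsum_congr fun c => ?_
    have := volume_closedBall_mul (c : E) (t := 10) (r := r c) (by norm_num) (hr c).le
    rw [show 2 * (5 * r c) = 10 * r c by ring, this]
    simp [n]
  have hconv : ∀ h : E → ℝ, Integrable h → AEStronglyMeasurable (K ⋆ h) volume := fun h hh =>
    (hK.integrable_convolution (ContinuousLinearMap.lsmul ℝ ℝ) hh).aestronglyMeasurable
  have hgood : volume {x | a ≤ ‖(K ⋆ g) x‖ₑ} ≤ β ^ 2 * (F₂ / a ^ 2) + β ^ 2 * (5 ^ n) ^ 2 * V := by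
    have hset : {x | a ≤ ‖(K ⋆ g) x‖ₑ} = {x | a ^ 2 ≤ ‖(K ⋆ g) x‖ₑ ^ 2} := by
      ext x
      exact (ENNReal.pow_right_strictMono two_ne_zero).le_iff_le.symm
    have ha2 : a ^ 2 ≠ 0 := pow_ne_zero _ ha0
    have ha2t : a ^ 2 ≠ ⊤ := ENNReal.pow_ne_top hat
    rw [hset]
    calc volume {x | a ^ 2 ≤ ‖(K ⋆ g) x‖ₑ ^ 2}
        ≤ (∫⁻ x, ‖(K ⋆ g) x‖ₑ ^ 2) / a ^ 2 :=
          meas_ge_le_lintegral_div ((hconv g hgi).enorm.pow_const 2) ha2 ha2t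
      _ ≤ (β ^ 2 * (F₂ + (5 ^ n * a) ^ 2 * V)) / a ^ 2 := by
          gcongr
          exact (lintegral_sq_convolution_le hK hB hgi hgb).trans (by gcongr)
      _ = β ^ 2 * (F₂ / a ^ 2) + β ^ 2 * (5 ^ n) ^ 2 * V * (a ^ 2 * (a ^ 2)⁻¹) := by
          simp only [div_eq_mul_inv]
          ring
      _ = _ := by rw [ENNReal.mul_inv_cancel ha2 ha2t, mul_one]
  have hbad : volume (Dᶜ ∩ {x | a ≤ ∑' c, ‖(K ⋆ b c) x‖ₑ}) ≤ 2 * 5 ^ n * β * V := by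
    have hae : AEMeasurable (fun x => ∑' c, ‖(K ⋆ b c) x‖ₑ) (volume.restrict Dᶜ) :=
      (AEMeasurable.tsum fun c => (hconv _ (hbi c)).enorm).restrict
    have h1 := mul_meas_ge_le_lintegral₀ hae a
    rw [Measure.restrict_apply₀' hDm.compl.nullMeasurableSet, inter_comm] at h1
    have h2 : ∫⁻ x in Dᶜ, ∑' c, ‖(K ⋆ b c) x‖ₑ ≤ a * (2 * 5 ^ n * β * V) := by
      rw [lintegral_tsum fun c => (hconv _ (hbi c)).enorm.restrict]
      calc ∑' c, ∫⁻ x in Dᶜ, ‖(K ⋆ b c) x‖ₑ ≤ ∑' c, β * ∫⁻ x, ‖b c x‖ₑ := by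
            refine ENNReal.tsum_le_tsum fun c => ?_
            refine le_trans (lintegral_mono_set ?_) (lintegral_convolution_compl_closedBall_le hKm
              hK hH (hbm c) (hbi c) (hb0 c) (hbs c))
            exact compl_subset_compl.mpr (subset_iUnion
              (fun c : u => closedBall (c : E) (2 * (5 * r c))) c)
        _ ≤ β * (2 * (5 ^ n * a) * V) := by
            rw [ENNReal.tsum_mul_left]
            gcongr
        _ = _ := by ring
    exact (ENNReal.mul_le_mul_iff_right ha0 hat).mp (h1.trans h2)
  have hsub : {x | 2 * l < ‖(K ⋆ f) x‖} ≤ᵐ[volume] ({x | a ≤ ‖(K ⋆ g) x‖ₑ} ∪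
      (D ∪ (Dᶜ ∩ {x | a ≤ ∑' c, ‖(K ⋆ b c) x‖ₑ})) : Set E) := by
    filter_upwards [ae_convolution_add_tsum hKm hK hf hgi hbm hsbt hfg] with x hx hxl
    change 2 * l < ‖(K ⋆ f) x‖ at hxl
    by_contra hcon
    change ¬ (x ∈ {x | a ≤ ‖(K ⋆ g) x‖ₑ} ∪ (D ∪ (Dᶜ ∩ {x | a ≤ ∑' c, ‖(K ⋆ b c) x‖ₑ}))) at hcon
    simp only [mem_union, mem_inter_iff, mem_compl_iff, mem_ofPred_eq, not_or, not_and, not_le]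
      at hcon
    obtain ⟨h1, h2, h3⟩ := hcon
    have h4 : ‖(K ⋆ f) x‖ₑ < a + a := by
      rw [hx]
      refine (enorm_add_le _ _).trans_lt (ENNReal.add_lt_add h1 ?_)
      exact enorm_tsum_le_tsum_enorm.trans_lt (h3 h2)
    rw [← ofReal_norm, ha, ← ENNReal.ofReal_add hl.le hl.le,
      ENNReal.ofReal_lt_ofReal_iff (by linarith)] at h4
    linarith
  calc volume {x | 2 * l < ‖(K ⋆ f) x‖}
      ≤ volume {x | a ≤ ‖(K ⋆ g) x‖ₑ} +
          (volume D + volume (Dᶜ ∩ {x | a ≤ ∑' c, ‖(K ⋆ b c) x‖ₑ})) :=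
        (measure_mono_ae hsub).trans ((measure_union_le _ _).trans (by
          gcongr
          exact measure_union_le _ _))
    _ ≤ (β ^ 2 * (F₂ / a ^ 2) + β ^ 2 * (5 ^ n) ^ 2 * V) + (10 ^ n * V + 2 * 5 ^ n * β * V) := by
        gcongr
    _ = β ^ 2 * (F₂ / a ^ 2) + (β ^ 2 * (5 ^ n) ^ 2 + 10 ^ n + 2 * 5 ^ n * β) * V := by ring
    _ ≤ β ^ 2 * (F₂ / a ^ 2) +
          (β ^ 2 * (5 ^ n) ^ 2 + 10 ^ n + 2 * 5 ^ n * β) * (2 * (F₁ / a)) := by gcongr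
    _ = β ^ 2 * (F₂ / a ^ 2) +
          2 * (β ^ 2 * (5 ^ n) ^ 2 + 10 ^ n + 2 * 5 ^ n * β) * (F₁ / a) := by ring
    _ ≤ _ := by
        rw [mul_add _ (F₂ / a ^ 2)]
        gcongr
        · exact le_self_add
        · exact le_add_self

end LevelSets

section Marcinkiewicz

open Metric Set Module

theorem lintegral_Ici_rpow {a s : ℝ} (ha : a < -1) (hs : 0 < s) :
    ∫⁻ t in Ici s, ENNReal.ofReal (t ^ a) = ENNReal.ofReal (s ^ (a + 1) / -(a + 1)) := by
  rw [setLIntegral_congr Ioi_ae_eq_Ici.symm, ← ofReal_integral_eq_lintegral_ofReal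
    (integrableOn_Ioi_rpow_of_lt ha hs), integral_Ioi_rpow_of_lt ha hs, neg_div, div_neg]
  filter_upwards [ae_restrict_mem measurableSet_Ioi] with t ht
  exact Real.rpow_nonneg (hs.le.trans (le_of_lt ht)) _

theorem lintegral_Ioc_rpow {a s : ℝ} (ha : -1 < a) (hs : 0 ≤ s) :
    ∫⁻ t in Ioc 0 s, ENNReal.ofReal (t ^ a) = ENNReal.ofReal (s ^ (a + 1) / (a + 1)) := by
  rw [← ofReal_integral_eq_lintegral_ofReal
    ((intervalIntegrable_iff_integrableOn_Ioc_of_le hs).mp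
      (intervalIntegral.intervalIntegrable_rpow' ha)),
    ← intervalIntegral.integral_of_le hs, integral_rpow (Or.inl ha),
    Real.zero_rpow (by linarith), sub_zero]
  filter_upwards [ae_restrict_mem measurableSet_Ioc] with t ht
  exact Real.rpow_nonneg (le_of_lt ht.1) _

variable {X : Type*} [MeasurableSpace X] {μ : Measure X}

theorem lintegral_lintegral_indicator_swap [SFinite μ] {w : ℝ → ℝ≥0∞} {F : X → ℝ≥0∞}
    {S : Set (X × ℝ)} (hw : Measurable w) (hF : Measurable F) (hS : MeasurableSet S) :
    ∫⁻ t in Ioi (0 : ℝ), (∫⁻ x in {x | (x, t) ∈ S}, F x ∂μ) * w t =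
      ∫⁻ x, F x * (∫⁻ t in Ioi 0 ∩ {t | (x, t) ∈ S}, w t) ∂μ := by
  have hleft : ∀ t, (∫⁻ x in {x | (x, t) ∈ S}, F x ∂μ) * w t =
      ∫⁻ x, S.indicator (fun p => F p.1 * w p.2) (x, t) ∂μ := fun t => by
    have : ∀ x, S.indicator (fun p => F p.1 * w p.2) (x, t) =
        {x | (x, t) ∈ S}.indicator (fun x => F x * w t) x := fun x => rfl
    simp_rw [this]
    have hm : MeasurableSet {x | (x, t) ∈ S} := measurable_prodMk_right hS
    rw [lintegral_indicator hm, lintegral_mul_const _ hF]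
  have hright : ∀ x, F x * ∫⁻ t in Ioi 0 ∩ {t | (x, t) ∈ S}, w t =
      ∫⁻ t in Ioi 0, S.indicator (fun p => F p.1 * w p.2) (x, t) := fun x => by
    have : ∀ t, S.indicator (fun p => F p.1 * w p.2) (x, t) =
        {t | (x, t) ∈ S}.indicator (fun t => F x * w t) t := fun t => rfl
    simp_rw [this]
    have hm : MeasurableSet {t | (x, t) ∈ S} := measurable_prodMk_left hS
    rw [lintegral_indicator hm, lintegral_const_mul _ hw, Measure.restrict_restrict hm, inter_comm]
  simp_rw [hleft, hright]
  refine lintegral_lintegral_swap (Measurable.aemeasurable ?_)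
  exact (((hF.comp measurable_fst).mul (hw.comp measurable_snd)).indicator hS).comp
    measurable_swap

theorem lintegral_truncation_sq_le [SFinite μ] {f : X → ℝ} (hf : Measurable f) {p : ℝ}
    (hp2 : p < 2) :
    ∫⁻ t in Ioi (0 : ℝ), (∫⁻ x in {x | ‖f x‖ ≤ t}, ‖f x‖ₑ ^ 2 ∂μ) * ENNReal.ofReal (t ^ (p - 3)) ≤
      ENNReal.ofReal (1 / (2 - p)) * ∫⁻ x, ‖f x‖ₑ ^ p ∂μ := by
  have hS : MeasurableSet {q : X × ℝ | ‖f q.1‖ ≤ q.2} :=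
    measurableSet_le (hf.comp measurable_fst).norm measurable_snd
  refine (lintegral_lintegral_indicator_swap (w := fun t => ENNReal.ofReal (t ^ (p - 3)))
    (F := fun x => ‖f x‖ₑ ^ 2) (by fun_prop) (by fun_prop) hS).trans_le ?_
  rw [← lintegral_const_mul _ (by fun_prop)]
  refine lintegral_mono fun x => ?_
  change ‖f x‖ₑ ^ 2 * ∫⁻ t in Ioi 0 ∩ Ici ‖f x‖, ENNReal.ofReal (t ^ (p - 3)) ≤ _
  rcases (norm_nonneg (f x)).eq_or_lt with h0 | h0
  · rw [← ofReal_norm, ← h0]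
    simp
  · rw [inter_eq_right.mpr (Ici_subset_Ioi.mpr h0), lintegral_Ici_rpow (by linarith) h0,
      ← ofReal_norm, ← ENNReal.ofReal_pow h0.le, ENNReal.ofReal_rpow_of_pos h0,
      ← ENNReal.ofReal_mul (by positivity),
      ← ENNReal.ofReal_mul (one_div_nonneg.mpr (by linarith))]
    refine ENNReal.ofReal_le_ofReal (le_of_eq ?_)
    have : ‖f x‖ ^ p = ‖f x‖ ^ 2 * ‖f x‖ ^ (p - 3 + 1) := by
      rw [← Real.rpow_natCast, ← Real.rpow_add h0]
      congr 1
      push_cast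
      ring
    rw [this, show -(p - 3 + 1) = 2 - p by ring]
    ring

theorem lintegral_truncation_le [SFinite μ] {f : X → ℝ} (hf : Measurable f) {p : ℝ}
    (hp : 1 < p) :
    ∫⁻ t in Ioi (0 : ℝ), (∫⁻ x in {x | t / 2 < ‖f x‖}, ‖f x‖ₑ ∂μ) * ENNReal.ofReal (t ^ (p - 2)) ≤
      ENNReal.ofReal (2 ^ (p - 1) / (p - 1)) * ∫⁻ x, ‖f x‖ₑ ^ p ∂μ := by
  have hS : MeasurableSet {q : X × ℝ | q.2 / 2 < ‖f q.1‖} :=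
    measurableSet_lt (measurable_snd.div_const 2) (hf.comp measurable_fst).norm
  refine (lintegral_lintegral_indicator_swap (w := fun t => ENNReal.ofReal (t ^ (p - 2)))
    (F := fun x => ‖f x‖ₑ) (by fun_prop) (by fun_prop) hS).trans_le ?_
  rw [← lintegral_const_mul _ (by fun_prop)]
  refine lintegral_mono fun x => ?_
  change ‖f x‖ₑ * ∫⁻ t in Ioi 0 ∩ {t | t / 2 < ‖f x‖}, ENNReal.ofReal (t ^ (p - 2)) ≤ _
  have hsub : Ioi 0 ∩ {t | t / 2 < ‖f x‖} ⊆ Ioc 0 (2 * ‖f x‖) := by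
    rintro t ⟨h1, h2⟩
    change t / 2 < ‖f x‖ at h2
    exact ⟨h1, by linarith⟩
  have h0 := norm_nonneg (f x)
  calc ‖f x‖ₑ * ∫⁻ t in Ioi 0 ∩ {t | t / 2 < ‖f x‖}, ENNReal.ofReal (t ^ (p - 2))
      ≤ ‖f x‖ₑ * ∫⁻ t in Ioc 0 (2 * ‖f x‖), ENNReal.ofReal (t ^ (p - 2)) := by
        gcongr
    _ = ENNReal.ofReal (2 ^ (p - 1) / (p - 1)) * ‖f x‖ₑ ^ p := by
        rw [lintegral_Ioc_rpow (by linarith) (by positivity), ← ofReal_norm,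
          ENNReal.ofReal_rpow_of_nonneg h0 (by linarith), ← ENNReal.ofReal_mul h0,
          ← ENNReal.ofReal_mul (div_nonneg (by positivity) (by linarith))]
        congr 1
        have : ‖f x‖ ^ p = ‖f x‖ * ‖f x‖ ^ (p - 1) := by
          rw [mul_comm, Real.rpow_sub_one' h0 (by linarith)]
          rcases h0.eq_or_lt with h | h
          · simp [← h, Real.zero_rpow (show p ≠ 0 by linarith)]
          · field_simp
        rw [this, show p - 2 + 1 = p - 1 by ring, Real.mul_rpow (by norm_num) h0]
        ring

/-- Marcinkiewicz interpolation for an operator with values `u` satisfying a two-sided truncation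
level set estimate. -/
theorem lintegral_rpow_le_of_level_sets [SFinite μ] {f u : X → ℝ} (hf : Measurable f)
    (hu : AEStronglyMeasurable u μ) {C : ℝ≥0∞} (hC : C ≠ ⊤)
    (hlev : ∀ l : ℝ, 0 < l → μ {x | 2 * l < ‖u x‖} ≤
      C * ((∫⁻ x in {x | ‖f x‖ ≤ l}, ‖f x‖ₑ ^ 2 ∂μ) / ENNReal.ofReal l ^ 2 +
        (∫⁻ x in {x | l / 2 < ‖f x‖}, ‖f x‖ₑ ∂μ) / ENNReal.ofReal l)) {p : ℝ}
    (hp : 1 < p) (hp2 : p < 2) :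
    ∫⁻ x, ‖u x‖ₑ ^ p ∂μ ≤ ENNReal.ofReal (2 ^ p * p) * C *
      (ENNReal.ofReal (1 / (2 - p)) + ENNReal.ofReal (2 ^ (p - 1) / (p - 1))) *
        ∫⁻ x, ‖f x‖ₑ ^ p ∂μ := by
  have hp0 : 0 < p := by linarith
  have hlayer := lintegral_rpow_eq_lintegral_meas_lt_mul μ (f := fun x => ‖u x‖ / 2)
    (Filter.Eventually.of_forall fun x => by positivity) (hu.norm.aemeasurable.div_const 2) hp0
  have hscale : ∫⁻ x, ‖u x‖ₑ ^ p ∂μ =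
      ENNReal.ofReal (2 ^ p) * ∫⁻ x, ENNReal.ofReal ((‖u x‖ / 2) ^ p) ∂μ := by
    rw [← lintegral_const_mul' _ _ ENNReal.ofReal_ne_top]
    refine lintegral_congr fun x => ?_
    rw [← ENNReal.ofReal_mul (by positivity), ← ofReal_norm,
      ENNReal.ofReal_rpow_of_nonneg (norm_nonneg _) hp0.le,
      ← Real.mul_rpow (by norm_num) (by positivity)]
    congr 2
    ring
  set Φ : ℝ → ℝ≥0∞ := fun t => (∫⁻ x in {x | ‖f x‖ ≤ t}, ‖f x‖ₑ ^ 2 ∂μ) *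
    ENNReal.ofReal (t ^ (p - 3))
  set Ψ : ℝ → ℝ≥0∞ := fun t => (∫⁻ x in {x | t / 2 < ‖f x‖}, ‖f x‖ₑ ∂μ) *
    ENNReal.ofReal (t ^ (p - 2))
  have hmono : Monotone fun t : ℝ => ∫⁻ x in {x | ‖f x‖ ≤ t}, ‖f x‖ₑ ^ 2 ∂μ := fun s t hst =>
    lintegral_mono_set fun x hx => le_trans (show ‖f x‖ ≤ s from hx) hst
  have hΦ : Measurable Φ := hmono.measurable.mul (by fun_prop)
  have hbound : ∫⁻ t in Ioi (0 : ℝ), μ {x | t < ‖u x‖ / 2} * ENNReal.ofReal (t ^ (p - 1)) ≤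
      C * (∫⁻ t in Ioi 0, Φ t) + C * ∫⁻ t in Ioi 0, Ψ t := by
    calc ∫⁻ t in Ioi (0 : ℝ), μ {x | t < ‖u x‖ / 2} * ENNReal.ofReal (t ^ (p - 1))
        ≤ ∫⁻ t in Ioi 0, C * (Φ t + Ψ t) := by
          refine setLIntegral_mono' measurableSet_Ioi fun t ht => ?_
          have ht : 0 < t := ht
          have hset : {x | t < ‖u x‖ / 2} = {x | 2 * t < ‖u x‖} := by
            ext x
            simp only [mem_ofPred_eq]
            constructor <;> intro h <;> linarith
          rw [hset]
          have h1 : ENNReal.ofReal (t ^ (p - 1)) / ENNReal.ofReal t ^ 2 =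
              ENNReal.ofReal (t ^ (p - 3)) := by
            rw [← ENNReal.ofReal_pow ht.le, ← ENNReal.ofReal_div_of_pos (by positivity),
              ← Real.rpow_natCast, ← Real.rpow_sub ht]
            congr 2
            push_cast
            ring
          have h2 : ENNReal.ofReal (t ^ (p - 1)) / ENNReal.ofReal t =
              ENNReal.ofReal (t ^ (p - 2)) := by
            rw [← ENNReal.ofReal_div_of_pos ht, ← Real.rpow_sub_one ht.ne']
            congr 2
            ring
          calc μ {x | 2 * t < ‖u x‖} * ENNReal.ofReal (t ^ (p - 1))
              ≤ _ := mul_le_mul_left (hlev t ht) _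
            _ = C * (Φ t + Ψ t) := by
                simp only [Φ, Ψ, ← h1, ← h2, div_eq_mul_inv]
                ring
      _ ≤ _ := by
          rw [lintegral_const_mul' _ _ hC, lintegral_add_left hΦ, mul_add]
  rw [hscale, hlayer, ← mul_assoc, ← ENNReal.ofReal_mul (by positivity)]
  calc ENNReal.ofReal (2 ^ p * p) *
        ∫⁻ t in Ioi (0 : ℝ), μ {x | t < ‖u x‖ / 2} * ENNReal.ofReal (t ^ (p - 1))
      ≤ ENNReal.ofReal (2 ^ p * p) *
          (C * (ENNReal.ofReal (1 / (2 - p)) * ∫⁻ x, ‖f x‖ₑ ^ p ∂μ) +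
            C * (ENNReal.ofReal (2 ^ (p - 1) / (p - 1)) * ∫⁻ x, ‖f x‖ₑ ^ p ∂μ)) := by
        gcongr
        refine hbound.trans ?_
        gcongr
        · exact lintegral_truncation_sq_le hf hp2
        · exact lintegral_truncation_le hf hp
    _ = _ := by ring

end Marcinkiewicz

section CalderonZygmundTheorem

open Metric Set Module

variable {E : Type*} [NormedAddCommGroup E] [InnerProductSpace ℝ E] [FiniteDimensional ℝ E]
  [MeasurableSpace E] [BorelSpace E]

/-- An integrable convolution kernel whose Fourier transform and Hörmander constant are bounded
by `B`. -/
structure IsCalderonZygmundKernel (K : E → ℝ) (B : ℝ) : Prop where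
  measurable : Measurable K
  integrable : Integrable K
  norm_fourier_le : ∀ ξ, ‖𝓕 (fun y => (K y : ℂ)) ξ‖ ≤ B
  hormander : ∀ v : E, ∫⁻ y in {y | 2 * ‖v‖ < ‖y‖}, ‖K (y - v) - K y‖ₑ ≤ ENNReal.ofReal B

theorem IsCalderonZygmundKernel.comp_neg {K : E → ℝ} {B : ℝ} (hK : IsCalderonZygmundKernel K B) :
    IsCalderonZygmundKernel (fun y => K (-y)) B := by
  have hm := hK.measurable
  refine ⟨hm.comp measurable_neg, hK.integrable.comp_neg, fun ξ => ?_, fun v => ?_⟩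
  · have : 𝓕 (fun y => (K (-y) : ℂ)) ξ = 𝓕 (fun y => (K y : ℂ)) (-ξ) := by
      rw [Real.fourier_eq, Real.fourier_eq, ← integral_neg_eq_self]
      simp
    rw [this]
    exact hK.norm_fourier_le _
  · refine le_trans (le_of_eq ?_) (hK.hormander (-v))
    have := (Measure.measurePreserving_neg (volume : Measure E)).setLIntegral_comp_preimage
      (s := {y | 2 * ‖-v‖ < ‖y‖}) (measurableSet_lt measurable_const measurable_norm)
      (f := fun y => ‖K (y - -v) - K y‖ₑ) (by fun_prop)
    rw [← this]
    simp only [preimage_ofPred_eq, norm_neg, sub_neg_eq_add, neg_sub, neg_add_eq_sub]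

theorem eLpNorm_ofReal_eq {X : Type*} [MeasurableSpace X] {μ : Measure X} (f : X → ℝ) {p : ℝ}
    (hp : 0 < p) : eLpNorm f (ENNReal.ofReal p) μ = (∫⁻ x, ‖f x‖ₑ ^ p ∂μ) ^ (1 / p) := by
  rw [eLpNorm_eq_lintegral_rpow_enorm_toReal (by simpa using hp) ENNReal.ofReal_ne_top,
    ENNReal.toReal_ofReal hp.le]

theorem exists_eLpNorm_convolution_le_of_lt_two [Nontrivial E] (B : ℝ) {p : ℝ} (hp : 1 < p)
    (hp2 : p < 2) : ∃ C : ℝ, 0 ≤ C ∧ ∀ K : E → ℝ, IsCalderonZygmundKernel K B →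
      ∀ f : E → ℝ, Continuous f → Integrable f →
        eLpNorm (K ⋆ f) (ENNReal.ofReal p) volume ≤
          ENNReal.ofReal C * eLpNorm f (ENNReal.ofReal p) volume := by
  set C₀ : ℝ≥0∞ := ENNReal.ofReal B ^ 2 + 2 * (ENNReal.ofReal B ^ 2 * (5 ^ finrank ℝ E) ^ 2 +
        10 ^ finrank ℝ E + 2 * 5 ^ finrank ℝ E * ENNReal.ofReal B) with hC₀
  have hC₀t : C₀ ≠ ⊤ := by
    simp only [hC₀]
    finiteness
  set C₁ : ℝ≥0∞ := ENNReal.ofReal (2 ^ p * p) * C₀ *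
      (ENNReal.ofReal (1 / (2 - p)) + ENNReal.ofReal (2 ^ (p - 1) / (p - 1)))
  have hp0 : 0 < p := by linarith
  have hC₁t : C₁ ^ (1 / p) ≠ ⊤ := ENNReal.rpow_ne_top_of_nonneg (by positivity)
    (ENNReal.mul_ne_top (ENNReal.mul_ne_top ENNReal.ofReal_ne_top hC₀t)
      (ENNReal.add_ne_top.mpr ⟨ENNReal.ofReal_ne_top, ENNReal.ofReal_ne_top⟩))
  refine ⟨(C₁ ^ (1 / p)).toReal, ENNReal.toReal_nonneg, fun K hK f hc hf => ?_⟩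
  rw [ENNReal.ofReal_toReal hC₁t, eLpNorm_ofReal_eq _ hp0, eLpNorm_ofReal_eq _ hp0,
    ← ENNReal.mul_rpow_of_nonneg _ _ (by positivity)]
  gcongr
  exact lintegral_rpow_le_of_level_sets hc.measurable
    (hK.integrable.integrable_convolution (ContinuousLinearMap.lsmul ℝ ℝ) hf).aestronglyMeasurable
    hC₀t (fun l hl => volume_convolution_gt_le hK.measurable hK.integrable hK.norm_fourier_le
      hK.hormander hc hf hl) hp hp2

theorem integral_convolution_mul {K f g : E → ℝ} (hK : Integrable K) (hf : Integrable f)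
    (hg : Continuous g) {M : ℝ} (hM : ∀ x, ‖g x‖ ≤ M) :
    ∫ x, (K ⋆ f) x * g x = ∫ y, f y * ((fun z => K (-z)) ⋆ g) y := by
  have h1 : Integrable (fun q : E × E => K (q.1 - q.2) * f q.2) (volume.prod volume) := by
    have := hf.convolution_integrand (ContinuousLinearMap.lsmul ℝ ℝ) hK
    refine this.congr (Filter.Eventually.of_forall fun q => ?_)
    simp [mul_comm]
  have h2 : Integrable (Function.uncurry fun x y : E => K (x - y) * f y * g x)
      (volume.prod volume) := by
    refine h1.mul_bdd (c := M) (hg.comp continuous_fst).aestronglyMeasurable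
      (Filter.Eventually.of_forall fun q => hM _)
  simp_rw [convolution_real_apply_swap, ← integral_mul_const, neg_sub, ← integral_const_mul]
  rw [integral_integral_swap h2]
  refine integral_congr_ae (Filter.Eventually.of_forall fun y =>
    integral_congr_ae (Filter.Eventually.of_forall fun x => ?_))
  ring

theorem continuous_convolution_of_bounded {K f : E → ℝ} (hK : Integrable K) (hc : Continuous f)
    {M : ℝ} (hM : ∀ x, ‖f x‖ ≤ M) : Continuous (K ⋆ f) :=
  BddAbove.continuous_convolution_right_of_integrable (ContinuousLinearMap.lsmul ℝ ℝ)
    ⟨M, by rintro _ ⟨x, rfl⟩; exact hM x⟩ hK hc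

theorem exists_eLpNorm_convolution_le_of_two_lt [Nontrivial E] (B : ℝ) {p : ℝ} (hp2 : 2 < p) :
    ∃ C : ℝ, 0 ≤ C ∧ ∀ K : E → ℝ, IsCalderonZygmundKernel K B →
      ∀ f : E → ℝ, Continuous f → Integrable f → (∃ M : ℝ, ∀ x, ‖f x‖ ≤ M) →
        eLpNorm (K ⋆ f) (ENNReal.ofReal p) volume ≤
          ENNReal.ofReal C * eLpNorm f (ENNReal.ofReal p) volume := by
  have hp0 : 0 < p := by linarith
  have hpq : p.HolderConjugate p.conjExponent :=
    Real.HolderConjugate.conjExponent (by linarith)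
  set q := p.conjExponent with hq
  have hq0 : 0 < q := hpq.symm.pos
  have hq2 : q < 2 := by
    rw [hq, Real.conjExponent, div_lt_iff₀ (by linarith)]
    linarith
  obtain ⟨C, hC0, hC⟩ := exists_eLpNorm_convolution_le_of_lt_two (E := E) B hpq.symm.lt hq2
  refine ⟨C, hC0, fun K hK f hc hf ⟨M, hM⟩ => ?_⟩
  set u := K ⋆ f with hu
  have hui : Integrable u := hK.integrable.integrable_convolution _ hf
  have huc : Continuous u := continuous_convolution_of_bounded hK.integrable hc hM
  set M' := (∫ y, ‖K y‖) * M
  have hM' : ∀ x, ‖u x‖ ≤ M' := norm_convolution_le hK.integrable hM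
  have hM'0 : 0 ≤ M' := (norm_nonneg _).trans (hM' 0)
  set g : E → ℝ := fun x => ‖u x‖ ^ (p - 2) * u x with hg
  have hgc : Continuous g := (huc.norm.rpow_const fun x => Or.inr (by linarith)).mul huc
  have hgle : ∀ x, ‖g x‖ ≤ M' ^ (p - 2) * ‖u x‖ := fun x => by
    rw [hg, norm_mul, Real.norm_of_nonneg (by positivity)]
    gcongr
    exact hM' x
  have hgi : Integrable g := (hui.norm.const_mul (M' ^ (p - 2))).mono' hgc.aestronglyMeasurable
    (Filter.Eventually.of_forall hgle)
  have hgb : ∀ x, ‖g x‖ ≤ M' ^ (p - 2) * M' := fun x =>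
    (hgle x).trans (by gcongr; exact hM' x)
  set J := ∫⁻ x, ‖u x‖ₑ ^ p with hJ
  have hup : MemLp u (ENNReal.ofReal p) volume :=
    memLp_of_integrable_of_norm_le hui hM' (by linarith)
  have hJt : J ≠ ⊤ := by
    have h1 := hup.2.ne
    rw [eLpNorm_ofReal_eq _ hp0] at h1
    exact fun h => h1 (by rw [← hJ, h, ENNReal.top_rpow_of_pos (by positivity)])
  have hgnorm : ∀ x, ‖g x‖ = ‖u x‖ ^ (p - 1) := fun x => by
    rw [hg, norm_mul, Real.norm_of_nonneg (by positivity)]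
    rcases (norm_nonneg (u x)).eq_or_lt with h | h
    · rw [← h, mul_zero, Real.zero_rpow (by linarith)]
    · rw [← Real.rpow_add_one h.ne']
      congr 1
      ring
  have hgJ : ∫⁻ x, ‖g x‖ₑ ^ q = J := by
    refine lintegral_congr fun x => ?_
    rw [← ofReal_norm, ← ofReal_norm, hgnorm, ENNReal.ofReal_rpow_of_nonneg (by positivity) hq0.le,
      ENNReal.ofReal_rpow_of_nonneg (by positivity) hp0.le, ← Real.rpow_mul (norm_nonneg _),
      hpq.sub_one_mul_conj]
  have hJle : J ≤ ENNReal.ofReal C * eLpNorm f (ENNReal.ofReal p) volume * J ^ (1 / q) := by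
    calc J = ENNReal.ofReal (∫ x, u x * g x) := by
          rw [ofReal_integral_eq_lintegral_ofReal]
          · refine lintegral_congr fun x => ?_
            rw [← ofReal_norm, ENNReal.ofReal_rpow_of_nonneg (by positivity) hp0.le]
            congr 1
            rw [hg]
            rcases (norm_nonneg (u x)).eq_or_lt with h | h
            · rw [← h, norm_eq_zero.mp h.symm, Real.zero_rpow hp0.ne', zero_mul]
            · have h1 : ‖u x‖ ^ p = ‖u x‖ ^ (p - 2) * ‖u x‖ ^ (2 : ℝ) := by
                rw [← Real.rpow_add h]
                congr 1
                ring
              have h2 : ‖u x‖ ^ (2 : ℝ) = u x ^ 2 := by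
                rw [Real.rpow_two, Real.norm_eq_abs, sq_abs]
              rw [h1, h2]
              ring
          · exact hui.mul_bdd (c := M' ^ (p - 2) * M') hgc.aestronglyMeasurable
              (Filter.Eventually.of_forall hgb)
          · refine Filter.Eventually.of_forall fun x => ?_
            change 0 ≤ u x * (‖u x‖ ^ (p - 2) * u x)
            have : u x * (‖u x‖ ^ (p - 2) * u x) = ‖u x‖ ^ (p - 2) * (u x * u x) := by ring
            rw [this]
            exact mul_nonneg (by positivity) (mul_self_nonneg _)
      _ ≤ ‖∫ x, u x * g x‖ₑ := Real.ofReal_le_enorm _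
      _ = ‖∫ y, f y * ((fun z => K (-z)) ⋆ g) y‖ₑ := by
          rw [hu, integral_convolution_mul hK.integrable hf hgc hgb]
      _ ≤ ∫⁻ y, ‖f y‖ₑ * ‖((fun z => K (-z)) ⋆ g) y‖ₑ := by
          refine (enorm_integral_le_lintegral_enorm _).trans (le_of_eq ?_)
          simp_rw [enorm_mul]
      _ ≤ (∫⁻ y, ‖f y‖ₑ ^ p) ^ (1 / p) * (∫⁻ y, ‖((fun z => K (-z)) ⋆ g) y‖ₑ ^ q) ^ (1 / q) :=
          ENNReal.lintegral_mul_le_Lp_mul_Lq volume hpq hc.enorm.aemeasurable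
            (continuous_convolution_of_bounded hK.integrable.comp_neg hgc hgb).enorm.aemeasurable
      _ ≤ (∫⁻ y, ‖f y‖ₑ ^ p) ^ (1 / p) * (ENNReal.ofReal C * (∫⁻ y, ‖g y‖ₑ ^ q) ^ (1 / q)) := by
          rw [← eLpNorm_ofReal_eq _ hq0, ← eLpNorm_ofReal_eq _ hq0]
          gcongr
          exact hC _ hK.comp_neg g hgc hgi
      _ = _ := by
          rw [eLpNorm_ofReal_eq _ hp0, hgJ]
          ring
  rw [eLpNorm_ofReal_eq u hp0, ← hJ]
  rcases eq_or_ne J 0 with h0 | h0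
  · rw [h0, ENNReal.zero_rpow_of_pos (by positivity)]
    exact zero_le
  · have hsplit : J = J ^ (1 / p) * J ^ (1 / q) := by
      rw [← ENNReal.rpow_add _ _ h0 hJt, one_div, one_div, hpq.inv_add_inv_eq_one,
        ENNReal.rpow_one]
    have h1 : J ^ (1 / q) ≠ 0 := by simp [h0, hJt]
    have h2 : J ^ (1 / q) ≠ ⊤ := ENNReal.rpow_ne_top_of_nonneg (by positivity) hJt
    refine (ENNReal.mul_le_mul_iff_left h1 h2).mp ?_
    rwa [← hsplit]

/-- The Calderón–Zygmund theorem: convolution with a Calderón–Zygmund kernel is bounded on `L^p`,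
`1 < p < ∞`, with a bound depending only on the kernel constant. -/
theorem exists_eLpNorm_convolution_le [Nontrivial E] (B : ℝ) {p : ℝ} (hp : 1 < p) :
    ∃ C : ℝ, 0 ≤ C ∧ ∀ K : E → ℝ, IsCalderonZygmundKernel K B →
      ∀ f : E → ℝ, Continuous f → Integrable f → (∃ M : ℝ, ∀ x, ‖f x‖ ≤ M) →
        eLpNorm (K ⋆ f) (ENNReal.ofReal p) volume ≤
          ENNReal.ofReal C * eLpNorm f (ENNReal.ofReal p) volume := by
  rcases lt_trichotomy p 2 with h | h | h
  · obtain ⟨C, hC0, hC⟩ := exists_eLpNorm_convolution_le_of_lt_two (E := E) B hp h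
    exact ⟨C, hC0, fun K hK f hc hf _ => hC K hK f hc hf⟩
  · refine ⟨max B 0, le_max_right _ _, fun K hK f hc hf ⟨M, hM⟩ => ?_⟩
    rw [h, ENNReal.ofReal_ofNat]
    refine (eLpNorm_two_convolution_le hK.integrable hK.norm_fourier_le hf hM).trans ?_
    gcongr
    exact le_max_left _ _
  · exact exists_eLpNorm_convolution_le_of_two_lt B h

end CalderonZygmundTheorem

section DilationKernel

open Metric Set Module

variable {E : Type*} [NormedAddCommGroup E] [InnerProductSpace ℝ E] [FiniteDimensional ℝ E]
  [MeasurableSpace E] [BorelSpace E]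

/-- A compactly supported mean-zero profile which is Hölder continuous of order `ε` in `L¹`. -/
structure IsDilationProfile (φ : E → ℝ) (C ε : ℝ) : Prop where
  measurable : Measurable φ
  integrable : Integrable φ
  eq_zero : ∀ z, 1 ≤ ‖z‖ → φ z = 0
  integral_eq_zero : ∫ z, φ z = 0
  lintegral_enorm_le : ∫⁻ z, ‖φ z‖ₑ ≤ ENNReal.ofReal C
  modulus : ∀ v, ∫⁻ z, ‖φ (z - v) - φ z‖ₑ ≤ ENNReal.ofReal (C * ‖v‖ ^ ε)

/-- The superposition `∫₀¹ w(r) r⁻ⁿ φ(y / r) dr` of dilates of the profile `φ`. -/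
noncomputable def dilationKernel (w : ℝ → ℝ) (φ : E → ℝ) (y : E) : ℝ :=
  ∫ r in Ioc (0 : ℝ) 1, w r * (r⁻¹ ^ finrank ℝ E * φ (r⁻¹ • y))

theorem lintegral_dilation {r : ℝ} (hr : 0 < r) {f : E → ℝ≥0∞} (hf : Measurable f) :
    ∫⁻ y, ENNReal.ofReal (r⁻¹ ^ finrank ℝ E) * f (r⁻¹ • y) = ∫⁻ y, f y := by
  have hr' : 0 < r⁻¹ := inv_pos.2 hr
  have hm : Measurable fun y : E => r⁻¹ • y := by fun_prop
  rw [lintegral_const_mul (f := fun y : E => f (r⁻¹ • y)) _ (hf.comp hm), ← lintegral_map hf hm,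
    Measure.map_addHaar_smul volume hr'.ne', lintegral_smul_measure, smul_eq_mul, ← mul_assoc,
    ← ENNReal.ofReal_mul (by positivity), abs_of_pos (by positivity),
    mul_inv_cancel₀ (by positivity), ENNReal.ofReal_one, one_mul]

theorem integrable_dilation_prod {w : ℝ → ℝ} {φ : E → ℝ} (hw : Measurable w)
    (hwi : IntegrableOn w (Ioc 0 1)) (hφ : Measurable φ) (hφi : Integrable φ) :
    Integrable (fun p : ℝ × E => w p.1 * (p.1⁻¹ ^ finrank ℝ E * φ (p.1⁻¹ • p.2)))
      ((volume.restrict (Ioc (0 : ℝ) 1)).prod volume) := by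
  have hm : Measurable fun p : ℝ × E => w p.1 * (p.1⁻¹ ^ finrank ℝ E * φ (p.1⁻¹ • p.2)) := by
    fun_prop
  rw [integrable_prod_iff hm.aestronglyMeasurable]
  constructor
  · filter_upwards [ae_restrict_mem measurableSet_Ioc] with r hr
    exact ((hφi.comp_smul (inv_pos.2 hr.1).ne').const_mul _).const_mul _
  · refine (hwi.norm.mul_const (∫ z, ‖φ z‖)).congr ?_
    filter_upwards [ae_restrict_mem measurableSet_Ioc] with r hr
    have hr' : 0 < r⁻¹ := inv_pos.2 hr.1
    simp only [norm_mul]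
    rw [integral_const_mul, integral_const_mul,
      Measure.integral_comp_smul volume (fun z => ‖φ z‖), abs_of_pos (by positivity),
      Real.norm_of_nonneg (r := r⁻¹ ^ finrank ℝ E) (by positivity), smul_eq_mul,
      ← mul_assoc (r⁻¹ ^ _),
      mul_inv_cancel₀ (by positivity), one_mul]

theorem measurable_dilationKernel {w : ℝ → ℝ} {φ : E → ℝ} (hw : Measurable w)
    (hφ : Measurable φ) : Measurable (dilationKernel w φ) := by
  have hm : Measurable fun p : E × ℝ => w p.2 * (p.2⁻¹ ^ finrank ℝ E * φ (p.2⁻¹ • p.1)) := by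
    fun_prop
  exact (hm.stronglyMeasurable.integral_prod_right).measurable

theorem integrable_dilationKernel {w : ℝ → ℝ} {φ : E → ℝ} (hw : Measurable w)
    (hwi : IntegrableOn w (Ioc 0 1)) (hφ : Measurable φ) (hφi : Integrable φ) :
    Integrable (dilationKernel w φ) :=
  (integrable_dilation_prod hw hwi hφ hφi).integral_prod_right

theorem integral_dilationKernel_smul {F : Type*} [NormedAddCommGroup F] [NormedSpace ℝ F]
    [CompleteSpace F] {w : ℝ → ℝ} {φ : E → ℝ} (hw : Measurable w)
    (hwi : IntegrableOn w (Ioc 0 1)) (hφ : Measurable φ) (hφi : Integrable φ) {g : E → F}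
    (hg : Continuous g) {M : ℝ} (hM : ∀ y, ‖g y‖ ≤ M) :
    ∫ y, dilationKernel w φ y • g y
      = ∫ r in Ioc (0 : ℝ) 1, w r • ∫ z, φ z • g (r • z) := by
  have hInt := integrable_dilation_prod hw hwi hφ hφi
  have hInt' : Integrable (fun p : E × ℝ =>
      (w p.2 * (p.2⁻¹ ^ finrank ℝ E * φ (p.2⁻¹ • p.1))) • g p.1)
      (volume.prod (volume.restrict (Ioc (0 : ℝ) 1))) := by
    refine (hInt.swap.norm.mul_const M).mono' ?_ ?_
    · exact hInt.swap.aestronglyMeasurable.smul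
        (hg.comp continuous_fst).stronglyMeasurable.aestronglyMeasurable
    · refine Filter.Eventually.of_forall fun p => ?_
      rw [norm_smul]
      exact mul_le_mul_of_nonneg_left (hM _) (norm_nonneg _)
  calc ∫ y, dilationKernel w φ y • g y
      = ∫ y, ∫ r in Ioc (0 : ℝ) 1, (w r * (r⁻¹ ^ finrank ℝ E * φ (r⁻¹ • y))) • g y := by
        refine integral_congr_ae (Filter.Eventually.of_forall fun y => ?_)
        simp only [dilationKernel]
        rw [integral_smul_const]
    _ = ∫ r in Ioc (0 : ℝ) 1, ∫ y, (w r * (r⁻¹ ^ finrank ℝ E * φ (r⁻¹ • y))) • g y :=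
        integral_integral_swap hInt'
    _ = _ := by
        refine setIntegral_congr_fun measurableSet_Ioc fun r hr => ?_
        have hr' : 0 < r⁻¹ := inv_pos.2 hr.1
        have := Measure.integral_comp_smul volume (fun z => φ z • g (r • z)) r⁻¹
        simp only [smul_smul, mul_inv_cancel₀ hr.1.ne', one_smul] at this
        simp only [mul_smul]
        rw [integral_smul, integral_smul, this, abs_of_pos (by positivity), smul_smul (r⁻¹ ^ _),
          mul_inv_cancel₀ (by positivity), one_smul]

theorem dilationKernel_hormander {w : ℝ → ℝ} {φ : E → ℝ} {C ε : ℝ} (hw : Measurable w)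
    (hwi : IntegrableOn w (Ioc 0 1)) (hw0 : ∀ r ∈ Ioc (0 : ℝ) 1, |w r| ≤ r⁻¹)
    (hC : 0 ≤ C) (hε : 0 < ε) (hφ : IsDilationProfile φ C ε) (v : E) :
    ∫⁻ y in {y | 2 * ‖v‖ < ‖y‖}, ‖dilationKernel w φ (y - v) - dilationKernel w φ y‖ₑ
      ≤ ENNReal.ofReal (C / ε) := by
  have hφm := hφ.measurable
  rcases eq_or_ne v 0 with rfl | hv
  · simp
  have hv0 : 0 < ‖v‖ := norm_pos_iff.2 hv
  set S : Set E := {y | 2 * ‖v‖ < ‖y‖}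
  have hS : MeasurableSet S := measurableSet_lt measurable_const measurable_norm
  set k : ℝ → E → ℝ := fun r y => w r * (r⁻¹ ^ finrank ℝ E * φ (r⁻¹ • y)) with hk
  have hae : ∀ᵐ y, IntegrableOn (fun r => k r y) (Ioc 0 1) :=
    (integrable_dilation_prod hw hwi hφm hφ.integrable).prod_left_ae
  have hae' : ∀ᵐ y, IntegrableOn (fun r => k r (y - v)) (Ioc 0 1) :=
    (measurePreserving_sub_right volume v).quasiMeasurePreserving.ae hae
  have hkm : Measurable fun p : E × ℝ => ‖k p.2 (p.1 - v) - k p.2 p.1‖ₑ := by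
    simp only [hk]; fun_prop
  have hbound : ∀ r ∈ Ioc (0 : ℝ) 1, ∫⁻ y in S, ‖k r (y - v) - k r y‖ₑ
      ≤ (Ici ‖v‖).indicator
        (fun r => ENNReal.ofReal (C * ‖v‖ ^ ε) * ENNReal.ofReal (r ^ (-1 - ε))) r := by
    intro r hr
    have hr0 := hr.1
    by_cases hrv : ‖v‖ ≤ r
    · rw [indicator_of_mem (show r ∈ Ici ‖v‖ from hrv)]
      calc ∫⁻ y in S, ‖k r (y - v) - k r y‖ₑ
          ≤ ∫⁻ y, ‖k r (y - v) - k r y‖ₑ := setLIntegral_le_lintegral _ _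
        _ = ∫⁻ y, ‖w r‖ₑ * (ENNReal.ofReal (r⁻¹ ^ finrank ℝ E) *
              ‖φ (r⁻¹ • y - r⁻¹ • v) - φ (r⁻¹ • y)‖ₑ) := by
            refine lintegral_congr fun y => ?_
            have : ENNReal.ofReal (r⁻¹ ^ finrank ℝ E) = ‖r⁻¹ ^ finrank ℝ E‖ₑ :=
              (Real.enorm_of_nonneg (by positivity)).symm
            rw [this, ← enorm_mul, ← enorm_mul]
            simp only [hk, smul_sub]
            congr 1
            ring
        _ = ‖w r‖ₑ * ∫⁻ y, ‖φ (y - r⁻¹ • v) - φ y‖ₑ := by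
            rw [lintegral_const_mul _ (by fun_prop),
              lintegral_dilation hr0 (f := fun y => ‖φ (y - r⁻¹ • v) - φ y‖ₑ) (by fun_prop)]
        _ ≤ ENNReal.ofReal (r⁻¹) * ENNReal.ofReal (C * ‖r⁻¹ • v‖ ^ ε) := by
            refine mul_le_mul' ?_ (hφ.modulus _)
            rw [Real.enorm_eq_ofReal_abs]
            exact ENNReal.ofReal_le_ofReal (hw0 r hr)
        _ = _ := by
            rw [← ENNReal.ofReal_mul (by positivity), ← ENNReal.ofReal_mul (by positivity)]
            congr 1
            rw [norm_smul, Real.norm_of_nonneg (by positivity),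
              Real.mul_rpow (by positivity) (by positivity), Real.rpow_sub hr0,
              Real.rpow_neg_one, Real.inv_rpow hr0.le]
            ring
    · rw [indicator_of_notMem (show r ∉ Ici ‖v‖ from hrv)]
      push Not at hrv
      refine le_of_eq ?_
      rw [setLIntegral_congr_fun (g := fun _ => 0) hS, lintegral_zero]
      intro y hy
      have hy' : 2 * ‖v‖ < ‖y‖ := hy
      have h1 : r ≤ ‖y‖ := by linarith
      have h2 : r ≤ ‖y - v‖ := by linarith [norm_sub_norm_le y v]
      have hz : ∀ x : E, r ≤ ‖x‖ → φ (r⁻¹ • x) = 0 := fun x hx => hφ.eq_zero _ (by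
        rw [norm_smul, Real.norm_of_nonneg (by positivity), ← div_eq_inv_mul]
        exact (one_le_div hr0).2 hx)
      simp [hk, hz _ h1, hz _ h2]
  calc ∫⁻ y in S, ‖dilationKernel w φ (y - v) - dilationKernel w φ y‖ₑ
      ≤ ∫⁻ y in S, ∫⁻ r in Ioc (0 : ℝ) 1, ‖k r (y - v) - k r y‖ₑ := by
        refine lintegral_mono_ae ?_
        filter_upwards [ae_restrict_of_ae hae, ae_restrict_of_ae hae'] with y h1 h2
        simp only [dilationKernel]
        rw [← integral_sub h2 h1]
        exact enorm_integral_le_lintegral_enorm _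
    _ = ∫⁻ r in Ioc (0 : ℝ) 1, ∫⁻ y in S, ‖k r (y - v) - k r y‖ₑ :=
        lintegral_lintegral_swap hkm.aemeasurable
    _ ≤ ∫⁻ r in Ioc (0 : ℝ) 1, (Ici ‖v‖).indicator
        (fun r => ENNReal.ofReal (C * ‖v‖ ^ ε) * ENNReal.ofReal (r ^ (-1 - ε))) r :=
        setLIntegral_mono' measurableSet_Ioc hbound
    _ ≤ ∫⁻ r, (Ici ‖v‖).indicator
        (fun r => ENNReal.ofReal (C * ‖v‖ ^ ε) * ENNReal.ofReal (r ^ (-1 - ε))) r :=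
        setLIntegral_le_lintegral _ _
    _ = ENNReal.ofReal (C / ε) := by
        rw [lintegral_indicator measurableSet_Ici, lintegral_const_mul _ (by fun_prop),
          lintegral_Ici_rpow (by linarith) hv0, ← ENNReal.ofReal_mul (by positivity)]
        congr 1
        rw [show -1 - ε + 1 = -ε by ring, neg_neg, Real.rpow_neg hv0.le]
        have : 0 < ‖v‖ ^ ε := by positivity
        field_simp

theorem IsDilationProfile.norm_fourier_le_mul {φ : E → ℝ} {C ε : ℝ}
    (hφ : IsDilationProfile φ C ε) (η : E) :
    ‖𝓕 (fun y => (φ y : ℂ)) η‖ₑ ≤ ENNReal.ofReal (2 * Real.pi * C * ‖η‖) := by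
  have hφm := hφ.measurable
  have hφc : Integrable fun y => (φ y : ℂ) := hφ.integrable.ofReal
  have h0 : ∫ y, (φ y : ℂ) = 0 := by
    rw [integral_complex_ofReal, hφ.integral_eq_zero, Complex.ofReal_zero]
  have hmean : 𝓕 (fun y => (φ y : ℂ)) η
      = ∫ y, ((Real.fourierChar (-inner ℝ y η) : ℂ) - 1) * (φ y : ℂ) := by
    have h1 : Integrable fun y => (Real.fourierChar (-inner ℝ y η) : ℂ) * (φ y : ℂ) := by
      refine hφc.norm.mono' (by fun_prop) (Filter.Eventually.of_forall fun y => ?_)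
      rw [norm_mul, Circle.norm_coe, one_mul]
    simp only [sub_mul, one_mul]
    rw [integral_sub h1 hφc, h0, sub_zero, Real.fourier_eq]
    rfl
  rw [hmean]
  calc ‖∫ y, ((Real.fourierChar (-inner ℝ y η) : ℂ) - 1) * (φ y : ℂ)‖ₑ
      ≤ ∫⁻ y, ‖((Real.fourierChar (-inner ℝ y η) : ℂ) - 1) * (φ y : ℂ)‖ₑ :=
        enorm_integral_le_lintegral_enorm _
    _ ≤ ∫⁻ y, ENNReal.ofReal (2 * Real.pi * ‖η‖) * ‖φ y‖ₑ := by
        refine lintegral_mono fun y => ?_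
        rcases le_or_gt 1 ‖y‖ with hy | hy
        · simp [hφ.eq_zero y hy]
        rw [enorm_mul]
        refine mul_le_mul' ?_ (le_of_eq ?_)
        · rw [← ofReal_norm]
          refine ENNReal.ofReal_le_ofReal ?_
          rw [Real.fourierChar_apply, mul_comm _ Complex.I]
          refine (Real.norm_exp_I_mul_ofReal_sub_one_le).trans ?_
          rw [norm_mul, norm_mul, norm_neg, Real.norm_of_nonneg Real.pi_pos.le,
            Real.norm_two]
          have : ‖inner ℝ y η‖ ≤ 1 * ‖η‖ := (norm_inner_le_norm y η).trans (by gcongr)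
          rw [one_mul] at this
          gcongr
        · rw [← ofReal_norm, ← ofReal_norm, Complex.norm_real]
    _ = ENNReal.ofReal (2 * Real.pi * ‖η‖) * ∫⁻ y, ‖φ y‖ₑ :=
        lintegral_const_mul _ hφm.enorm
    _ ≤ ENNReal.ofReal (2 * Real.pi * ‖η‖) * ENNReal.ofReal C := by
        gcongr
        exact hφ.lintegral_enorm_le
    _ = _ := by
        rw [← ENNReal.ofReal_mul (by positivity)]
        congr 1
        ring

theorem IsDilationProfile.norm_fourier_le_rpow {φ : E → ℝ} {C ε : ℝ} (hC : 0 ≤ C)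
    (hε : 0 ≤ ε) (hφ : IsDilationProfile φ C ε) {η : E} (hη : η ≠ 0) :
    ‖𝓕 (fun y => (φ y : ℂ)) η‖ₑ ≤ ENNReal.ofReal (C * ‖η‖ ^ (-ε)) := by
  have hη0 : 0 < ‖η‖ := norm_pos_iff.2 hη
  have hφc : Integrable fun y => (φ y : ℂ) := hφ.integrable.ofReal
  rw [Real.fourier_eq, fourierIntegral_eq_half_sub_half_period_translate hη hφc]
  set u : E := (1 / (2 * ‖η‖ ^ 2) : ℝ) • η with hu
  have hun : ‖u‖ ≤ ‖η‖⁻¹ := by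
    rw [hu, norm_smul, Real.norm_of_nonneg (by positivity)]
    field_simp
    norm_num
  calc ‖(1 / 2 : ℂ) • ∫ y, Real.fourierChar (-inner ℝ y η) • ((φ y : ℂ) - (φ (y + u) : ℂ))‖ₑ
      ≤ 1 * ∫⁻ y, ‖Real.fourierChar (-inner ℝ y η) • ((φ y : ℂ) - (φ (y + u) : ℂ))‖ₑ := by
        rw [enorm_smul]
        refine mul_le_mul' ?_ (enorm_integral_le_lintegral_enorm _)
        rw [← ofReal_norm]
        norm_num
    _ = ∫⁻ y, ‖φ (y - -u) - φ y‖ₑ := by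
        rw [one_mul]
        refine lintegral_congr fun y => ?_
        rw [← ofReal_norm, ← ofReal_norm, Circle.norm_smul, ← Complex.ofReal_sub,
          Complex.norm_real, norm_sub_rev, sub_neg_eq_add]
    _ ≤ ENNReal.ofReal (C * ‖-u‖ ^ ε) := hφ.modulus _
    _ ≤ _ := by
        refine ENNReal.ofReal_le_ofReal ?_
        rw [norm_neg, Real.rpow_neg hη0.le, ← Real.inv_rpow hη0.le]
        gcongr

theorem fourier_dilationKernel {w : ℝ → ℝ} {φ : E → ℝ} (hw : Measurable w)
    (hwi : IntegrableOn w (Ioc 0 1)) (hφ : Measurable φ) (hφi : Integrable φ) (ξ : E) :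
    𝓕 (fun y => (dilationKernel w φ y : ℂ)) ξ
      = ∫ r in Ioc (0 : ℝ) 1, w r • 𝓕 (fun y => (φ y : ℂ)) (r • ξ) := by
  have := integral_dilationKernel_smul hw hwi hφ hφi
    (g := fun y => (Real.fourierChar (-inner ℝ y ξ) : ℂ)) (by fun_prop) (M := 1)
    (fun y => (Circle.norm_coe _).le)
  simp only [Real.fourier_eq, Circle.smul_def, smul_eq_mul]
  simp only [Complex.real_smul, mul_comm, inner_smul_left, inner_smul_right, RCLike.conj_to_real]
    at this ⊢
  exact this

theorem enorm_fourier_dilationKernel_le {w : ℝ → ℝ} {φ : E → ℝ} {C ε : ℝ} (hw : Measurable w)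
    (hwi : IntegrableOn w (Ioc 0 1)) (hw0 : ∀ r ∈ Ioc (0 : ℝ) 1, |w r| ≤ r⁻¹)
    (hC : 0 ≤ C) (hε : 0 < ε) (hφ : IsDilationProfile φ C ε) (ξ : E) :
    ‖𝓕 (fun y => (dilationKernel w φ y : ℂ)) ξ‖ₑ
      ≤ ENNReal.ofReal (2 * Real.pi * C + C / ε) := by
  rw [fourier_dilationKernel hw hwi hφ.measurable hφ.integrable]
  rcases eq_or_ne ξ 0 with rfl | hξ
  · have : 𝓕 (fun y => (φ y : ℂ)) 0 = 0 := by
      simp [Real.fourier_eq, integral_complex_ofReal, hφ.integral_eq_zero]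
    simp [this]
  have hξ0 : 0 < ‖ξ‖ := norm_pos_iff.2 hξ
  have hwe : ∀ r ∈ Ioc (0 : ℝ) 1, ‖w r‖ₑ ≤ ENNReal.ofReal r⁻¹ := fun r hr => by
    rw [Real.enorm_eq_ofReal_abs]
    exact ENNReal.ofReal_le_ofReal (hw0 r hr)
  calc ‖∫ r in Ioc (0 : ℝ) 1, w r • 𝓕 (fun y => (φ y : ℂ)) (r • ξ)‖ₑ
      ≤ ∫⁻ r in Ioc (0 : ℝ) 1, ‖w r • 𝓕 (fun y => (φ y : ℂ)) (r • ξ)‖ₑ :=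
        enorm_integral_le_lintegral_enorm _
    _ ≤ ∫⁻ r in Ioc (0 : ℝ) 1,
          ((Ioc 0 ‖ξ‖⁻¹).indicator (fun _ => ENNReal.ofReal (2 * Real.pi * C * ‖ξ‖)) r
          + (Ici ‖ξ‖⁻¹).indicator
            (fun r => ENNReal.ofReal (C * ‖ξ‖ ^ (-ε)) * ENNReal.ofReal (r ^ (-1 - ε))) r) := by
        refine setLIntegral_mono' measurableSet_Ioc fun r hr => ?_
        have hr0 := hr.1
        rw [enorm_smul]
        rcases le_or_gt r ‖ξ‖⁻¹ with hrξ | hrξ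
        · rw [indicator_of_mem (show r ∈ Ioc 0 ‖ξ‖⁻¹ from ⟨hr0, hrξ⟩)]
          refine le_add_right ?_
          refine (mul_le_mul' (hwe r hr) (hφ.norm_fourier_le_mul (r • ξ))).trans (le_of_eq ?_)
          rw [← ENNReal.ofReal_mul (by positivity), norm_smul, Real.norm_of_nonneg hr0.le]
          congr 1
          field_simp
        · rw [indicator_of_mem (show r ∈ Ici ‖ξ‖⁻¹ from hrξ.le)]
          refine le_add_left ?_
          refine (mul_le_mul' (hwe r hr)
            (hφ.norm_fourier_le_rpow hC hε.le (smul_ne_zero hr0.ne' hξ))).trans (le_of_eq ?_)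
          rw [← ENNReal.ofReal_mul (by positivity), ← ENNReal.ofReal_mul (by positivity),
            norm_smul, Real.norm_of_nonneg hr0.le, Real.mul_rpow hr0.le hξ0.le, sub_eq_add_neg,
            Real.rpow_add hr0, Real.rpow_neg_one]
          congr 1
          ring
    _ ≤ ∫⁻ r, ((Ioc 0 ‖ξ‖⁻¹).indicator (fun _ => ENNReal.ofReal (2 * Real.pi * C * ‖ξ‖)) r
          + (Ici ‖ξ‖⁻¹).indicator
            (fun r => ENNReal.ofReal (C * ‖ξ‖ ^ (-ε)) * ENNReal.ofReal (r ^ (-1 - ε))) r) :=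
        setLIntegral_le_lintegral _ _
    _ = ENNReal.ofReal (2 * Real.pi * C + C / ε) := by
        rw [lintegral_add_left (measurable_const.indicator measurableSet_Ioc),
          lintegral_indicator measurableSet_Ioc, setLIntegral_const, Real.volume_Ioc, sub_zero,
          lintegral_indicator measurableSet_Ici, lintegral_const_mul _ (by fun_prop),
          lintegral_Ici_rpow (by linarith) (by positivity),
          ← ENNReal.ofReal_mul (by positivity), ← ENNReal.ofReal_mul (by positivity),
          ← ENNReal.ofReal_add (by positivity)]
        · congr 1
          rw [show -1 - ε + 1 = -ε by ring, neg_neg, Real.inv_rpow hξ0.le, Real.rpow_neg hξ0.le,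
            inv_inv]
          have : 0 < ‖ξ‖ ^ ε := by positivity
          field_simp
        · rw [show -1 - ε + 1 = -ε by ring, neg_neg]
          positivity

theorem isCalderonZygmundKernel_dilationKernel {w : ℝ → ℝ} {φ : E → ℝ} {C ε : ℝ}
    (hw : Measurable w) (hwi : IntegrableOn w (Ioc 0 1))
    (hw0 : ∀ r ∈ Ioc (0 : ℝ) 1, |w r| ≤ r⁻¹) (hC : 0 ≤ C) (hε : 0 < ε)
    (hφ : IsDilationProfile φ C ε) :
    IsCalderonZygmundKernel (dilationKernel w φ) (2 * Real.pi * C + C / ε) where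
  measurable := measurable_dilationKernel hw hφ.measurable
  integrable := integrable_dilationKernel hw hwi hφ.measurable hφ.integrable
  norm_fourier_le ξ := by
    have := enorm_fourier_dilationKernel_le hw hwi hw0 hC hε hφ ξ
    rw [← ofReal_norm] at this
    exact (ENNReal.ofReal_le_ofReal_iff (by positivity)).1 this
  hormander v := (dilationKernel_hormander hw hwi hw0 hC hε hφ v).trans
    (ENNReal.ofReal_le_ofReal (le_add_of_nonneg_left (by positivity)))

end DilationKernel

section HomogeneousProfile

open Metric Set Module

variable {E : Type*} [NormedAddCommGroup E] [InnerProductSpace ℝ E] [FiniteDimensional ℝ E]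
  [MeasurableSpace E] [BorelSpace E]

theorem lintegral_norm_div_pow_le [Nontrivial E] {a b : ℝ} (hab : a ≤ b) :
    ∫⁻ z : E in (fun z => ‖z‖) ⁻¹' Ico a b, ENNReal.ofReal (‖z‖ * (‖z‖ ^ finrank ℝ E)⁻¹)
      ≤ ENNReal.ofReal (finrank ℝ E * volume.real (ball (0 : E) 1) * (b - a)) := by
  have hn : 0 < finrank ℝ E := finrank_pos
  set f : ℝ → ℝ := (Ico a b).indicator fun t => t * (t ^ finrank ℝ E)⁻¹ with hf
  have hS : MeasurableSet ((fun z : E => ‖z‖) ⁻¹' Ico a b) := measurable_norm measurableSet_Ico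
  have hone : ∀ y ∈ Ioi (0 : ℝ), (Ico a b).indicator (1 : ℝ → ℝ) y
      = y ^ (finrank ℝ E - 1) • f y := by
    intro y hy
    by_cases hyab : y ∈ Ico a b
    · have hy' : 0 < y := hy
      simp only [hf, indicator_of_mem hyab, Pi.one_apply, smul_eq_mul]
      rw [← mul_assoc, ← pow_succ, Nat.sub_add_cancel hn, mul_inv_cancel₀ (by positivity)]
    · simp [hf, indicator_of_notMem hyab]
  have hfi : IntegrableOn (fun y : ℝ => y ^ (finrank ℝ E - 1) • f y) (Ioi 0) := by
    refine IntegrableOn.congr_fun ?_ hone measurableSet_Ioi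
    exact ((integrable_indicator_iff measurableSet_Ico).2
      (integrableOn_const (by simp))).integrableOn
  have hInt : Integrable (fun z : E => f ‖z‖) := (integrable_fun_norm_addHaar volume).2 hfi
  calc ∫⁻ z : E in (fun z => ‖z‖) ⁻¹' Ico a b, ENNReal.ofReal (‖z‖ * (‖z‖ ^ finrank ℝ E)⁻¹)
      = ∫⁻ z : E, ENNReal.ofReal (f ‖z‖) := by
        rw [← lintegral_indicator hS]
        refine lintegral_congr fun z => ?_
        by_cases hz : ‖z‖ ∈ Ico a b
        · rw [indicator_of_mem (show z ∈ (fun z : E => ‖z‖) ⁻¹' Ico a b from hz), hf,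
            indicator_of_mem hz]
        · rw [indicator_of_notMem (show z ∉ (fun z : E => ‖z‖) ⁻¹' Ico a b from hz), hf,
            indicator_of_notMem hz, ENNReal.ofReal_zero]
    _ = ENNReal.ofReal (∫ z : E, f ‖z‖) := by
        refine (ofReal_integral_eq_lintegral_ofReal hInt ?_).symm
        refine Filter.Eventually.of_forall fun z => ?_
        by_cases hz : ‖z‖ ∈ Ico a b
        · simp only [hf, indicator_of_mem hz, Pi.zero_apply]
          positivity
        · simp [hf, indicator_of_notMem hz]
    _ ≤ _ := by
        refine ENNReal.ofReal_le_ofReal ?_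
        rw [integral_fun_norm_addHaar, nsmul_eq_mul, smul_eq_mul, mul_assoc]
        refine mul_le_mul_of_nonneg_left (mul_le_mul_of_nonneg_left ?_ (by positivity))
          (by positivity)
        rw [← setIntegral_congr_fun measurableSet_Ioi hone,
          integral_indicator_one measurableSet_Ico, measureReal_restrict_apply measurableSet_Ico]
        calc volume.real (Ico a b ∩ Ioi 0) ≤ volume.real (Ico a b) :=
              measureReal_mono inter_subset_left (by simp)
          _ = b - a := by simp [hab]

theorem abs_inv_pow_sub_inv_pow_le {δ a b : ℝ} (n : ℕ) (hδ : 0 < δ) (ha : δ ≤ a) (hb : δ ≤ b)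
    (ha1 : a ≤ 1) (hb1 : b ≤ 1) : |(a ^ n)⁻¹ - (b ^ n)⁻¹| ≤ n * |a - b| * (δ ^ (2 * n))⁻¹ := by
  have ha0 : 0 < a := hδ.trans_le ha
  have hb0 : 0 < b := hδ.trans_le hb
  have hpow : |b ^ n - a ^ n| ≤ n * |a - b| := by
    have := abs_pow_sub_pow_le b a n
    have hmax : max |b| |a| ≤ 1 := by
      rw [abs_of_pos ha0, abs_of_pos hb0]; exact max_le hb1 ha1
    calc |b ^ n - a ^ n| ≤ |b - a| * n * max |b| |a| ^ (n - 1) := this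
      _ ≤ |b - a| * n * 1 := by
          gcongr
          exact pow_le_one₀ (le_max_of_le_left (abs_nonneg _)) hmax
      _ = n * |a - b| := by rw [abs_sub_comm]; ring
  rw [inv_sub_inv (by positivity) (by positivity), abs_div,
    abs_of_pos (by positivity : 0 < a ^ n * b ^ n), div_eq_mul_inv]
  have : δ ^ (2 * n) ≤ a ^ n * b ^ n := by
    rw [two_mul, pow_add]
    gcongr
  gcongr

variable {F : E → ℝ} {K : NNReal}

/-- The profile `|z|⁻ⁿ F(z)` cut off to the unit ball. -/
noncomputable def ballProfile {E : Type*} [NormedAddCommGroup E] [InnerProductSpace ℝ E]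
    (F : E → ℝ) : E → ℝ :=
  (ball 0 1).indicator fun z => (‖z‖ ^ finrank ℝ E)⁻¹ * F z

theorem LipschitzWith.abs_le_mul_norm {E : Type*} [NormedAddCommGroup E] {F : E → ℝ}
    {K : NNReal} (hF : LipschitzWith K F) (hF0 : F 0 = 0) (z : E) :
    |F z| ≤ K * ‖z‖ := by
  have := hF.dist_le_mul z 0
  rwa [hF0, dist_zero_right, dist_zero_right, Real.norm_eq_abs] at this

theorem enorm_ballProfile_le {E : Type*} [NormedAddCommGroup E] [InnerProductSpace ℝ E]
    {F : E → ℝ} {K : NNReal} (hF : LipschitzWith K F) (hF0 : F 0 = 0) (z : E) :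
    ‖ballProfile F z‖ₑ ≤ K * ENNReal.ofReal (‖z‖ * (‖z‖ ^ finrank ℝ E)⁻¹) := by
  by_cases hz : z ∈ ball (0 : E) 1
  · rw [ballProfile, indicator_of_mem hz, ← ENNReal.ofReal_coe_nnreal,
      ← ENNReal.ofReal_mul (by positivity), Real.enorm_eq_ofReal_abs, abs_mul,
      abs_of_nonneg (by positivity)]
    refine ENNReal.ofReal_le_ofReal ?_
    have := hF.abs_le_mul_norm hF0 z
    calc (‖z‖ ^ finrank ℝ E)⁻¹ * |F z| ≤ (‖z‖ ^ finrank ℝ E)⁻¹ * (K * ‖z‖) := by gcongr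
      _ = _ := by ring
  · simp [ballProfile, indicator_of_notMem hz]

theorem abs_ballProfile_sub_le {E : Type*} [NormedAddCommGroup E] [InnerProductSpace ℝ E]
    {F : E → ℝ} {K : NNReal} (hF : LipschitzWith K F) (hF0 : F 0 = 0) {δ : ℝ} (hδ : 0 < δ)
    {x y : E} (hx : δ ≤ ‖x‖) (hy : δ ≤ ‖y‖) (hx1 : ‖x‖ < 1) (hy1 : ‖y‖ < 1) :
    |ballProfile F x - ballProfile F y|
      ≤ K * (1 + finrank ℝ E) * (δ ^ (2 * finrank ℝ E))⁻¹ * ‖x - y‖ := by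
  set n := finrank ℝ E with hn
  have hδ1 : δ ≤ 1 := hx.trans hx1.le
  rw [ballProfile, indicator_of_mem (by simpa using hx1), indicator_of_mem (by simpa using hy1)]
  have hd : |F x - F y| ≤ K * ‖x - y‖ := by
    have := hF.dist_le_mul x y
    rwa [Real.dist_eq, dist_eq_norm] at this
  have hFy : |F y| ≤ K := (hF.abs_le_mul_norm hF0 y).trans
    (mul_le_of_le_one_right K.coe_nonneg hy1.le)
  have h1 : (‖x‖ ^ n)⁻¹ ≤ (δ ^ (2 * n))⁻¹ := by
    gcongr
    calc δ ^ (2 * n) ≤ δ ^ n := pow_le_pow_of_le_one hδ.le hδ1 (by omega)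
      _ ≤ ‖x‖ ^ n := by gcongr
  have h2 := abs_inv_pow_sub_inv_pow_le n hδ hx hy hx1.le hy1.le
  have h3 : |‖x‖ - ‖y‖| ≤ ‖x - y‖ := abs_norm_sub_norm_le x y
  calc |(‖x‖ ^ n)⁻¹ * F x - (‖y‖ ^ n)⁻¹ * F y|
      = |(‖x‖ ^ n)⁻¹ * (F x - F y) + ((‖x‖ ^ n)⁻¹ - (‖y‖ ^ n)⁻¹) * F y| := by ring_nf
    _ ≤ (‖x‖ ^ n)⁻¹ * |F x - F y| + |(‖x‖ ^ n)⁻¹ - (‖y‖ ^ n)⁻¹| * |F y| := by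
        refine (abs_add_le _ _).trans_eq ?_
        rw [abs_mul, abs_mul, abs_of_nonneg (a := (‖x‖ ^ n)⁻¹) (by positivity)]
    _ ≤ (δ ^ (2 * n))⁻¹ * (K * ‖x - y‖) + n * ‖x - y‖ * (δ ^ (2 * n))⁻¹ * K := by
        gcongr
        exact h2.trans (by gcongr)
    _ = _ := by ring

theorem lintegral_enorm_ballProfile_le [Nontrivial E] (hF : LipschitzWith K F) (hF0 : F 0 = 0) :
    ∫⁻ z, ‖ballProfile F z‖ₑ
      ≤ ENNReal.ofReal (K * (finrank ℝ E * volume.real (ball (0 : E) 1))) := by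
  have hS : MeasurableSet ((fun z : E => ‖z‖) ⁻¹' Ico 0 1) := measurable_norm measurableSet_Ico
  calc ∫⁻ z, ‖ballProfile F z‖ₑ
      = ∫⁻ z in (fun z : E => ‖z‖) ⁻¹' Ico 0 1, ‖ballProfile F z‖ₑ := by
        refine (setLIntegral_eq_of_support_subset fun z hz => ?_).symm
        by_contra hz1
        refine hz ?_
        simp only [ballProfile]
        rw [indicator_of_notMem, enorm_zero]
        intro h
        exact hz1 ⟨norm_nonneg z, by simpa using h⟩
    _ ≤ ∫⁻ z in (fun z : E => ‖z‖) ⁻¹' Ico 0 1,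
          K * ENNReal.ofReal (‖z‖ * (‖z‖ ^ finrank ℝ E)⁻¹) :=
        lintegral_mono fun z => enorm_ballProfile_le hF hF0 z
    _ ≤ K * ENNReal.ofReal (finrank ℝ E * volume.real (ball (0 : E) 1) * (1 - 0)) := by
        rw [lintegral_const_mul _ (by fun_prop)]
        gcongr
        exact lintegral_norm_div_pow_le zero_le_one
    _ = _ := by
        rw [← ENNReal.ofReal_coe_nnreal, ← ENNReal.ofReal_mul (by positivity), sub_zero, mul_one]

theorem measurable_ballProfile {E : Type*} [NormedAddCommGroup E] [InnerProductSpace ℝ E]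
    [MeasurableSpace E] [BorelSpace E] {F : E → ℝ} {K : NNReal} (hF : LipschitzWith K F) :
    Measurable (ballProfile F) := by
  have := hF.continuous.measurable
  refine Measurable.indicator ?_ measurableSet_ball
  fun_prop

theorem enorm_ballProfile_sub_le {E : Type*} [NormedAddCommGroup E] [InnerProductSpace ℝ E]
    {F : E → ℝ} {K : NNReal} (hF : LipschitzWith K F) (hF0 : F 0 = 0) {δ : ℝ} (hδ : 0 < δ)
    {v : E} (hv : ‖v‖ ≤ δ) (z : E) :
    ‖ballProfile F (z - v) - ballProfile F z‖ₑ ≤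
      K * ((((fun z => ‖z‖) ⁻¹' Ico 0 (2 * δ)).indicator
          (fun z : E => ENNReal.ofReal (‖z‖ * (‖z‖ ^ finrank ℝ E)⁻¹)) z
        + ((fun z => ‖z‖) ⁻¹' Ico (1 - δ) 1).indicator
          (fun z : E => ENNReal.ofReal (‖z‖ * (‖z‖ ^ finrank ℝ E)⁻¹)) z)
        + (((fun z => ‖z‖) ⁻¹' Ico 0 (3 * δ)).indicator
          (fun z : E => ENNReal.ofReal (‖z‖ * (‖z‖ ^ finrank ℝ E)⁻¹)) (z - v)
        + ((fun z => ‖z‖) ⁻¹' Ico (1 - 2 * δ) 1).indicator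
          (fun z : E => ENNReal.ofReal (‖z‖ * (‖z‖ ^ finrank ℝ E)⁻¹)) (z - v)))
      + (ball 0 1).indicator (fun _ => ENNReal.ofReal
          (K * (1 + finrank ℝ E) * (δ ^ (2 * finrank ℝ E))⁻¹ * ‖v‖)) z := by
  set m : E → ℝ≥0∞ := fun z => ENNReal.ofReal (‖z‖ * (‖z‖ ^ finrank ℝ E)⁻¹) with hm
  have htri : ‖z - v‖ ≤ ‖z‖ + ‖v‖ := norm_sub_le z v
  have htri' : ‖z‖ - ‖v‖ ≤ ‖z - v‖ := norm_sub_norm_le z v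
  have hle := enorm_ballProfile_le hF hF0
  have hzero : ∀ x : E, 1 ≤ ‖x‖ → ‖ballProfile F x‖ₑ = 0 := fun x hx => by
    rw [ballProfile, indicator_of_notMem (by simpa using hx), enorm_zero]
  have hbad : ∀ (x : E) {s : Set ℝ}, (‖x‖ < 1 → ‖x‖ ∈ s) →
      ‖ballProfile F x‖ₑ ≤ K * ((fun z : E => ‖z‖) ⁻¹' s).indicator m x := fun x s hx => by
    rcases lt_or_ge ‖x‖ 1 with h | h
    · rw [indicator_of_mem (show x ∈ (fun z : E => ‖z‖) ⁻¹' s from hx h)]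
      exact hle x
    · rw [hzero x h]; exact zero_le
  rcases lt_or_ge ‖z‖ (2 * δ) with h1 | h1
  · refine le_add_right (enorm_sub_le.trans ?_)
    rw [add_comm ‖ballProfile F (z - v)‖ₑ, mul_add, mul_add, mul_add]
    refine add_le_add (le_add_right ?_) (le_add_right ?_)
    · exact hbad z fun _ => ⟨norm_nonneg _, h1⟩
    · exact hbad _ fun _ => ⟨norm_nonneg _, by linarith⟩
  rcases le_or_gt (1 - δ) ‖z‖ with h2 | h2
  · refine le_add_right (enorm_sub_le.trans ?_)
    rw [add_comm ‖ballProfile F (z - v)‖ₑ, mul_add, mul_add, mul_add]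
    refine add_le_add (le_add_left ?_) (le_add_left ?_)
    · exact hbad z fun h => ⟨h2, h⟩
    · exact hbad _ fun h => ⟨by linarith, h⟩
  · refine le_add_left ?_
    rw [indicator_of_mem (by simp; linarith), Real.enorm_eq_ofReal_abs]
    refine ENNReal.ofReal_le_ofReal ?_
    have := abs_ballProfile_sub_le hF hF0 hδ (x := z - v) (y := z) (by linarith) (by linarith)
      (by linarith) (by linarith)
    rwa [sub_sub_cancel_left, norm_neg] at this

theorem lintegral_enorm_ballProfile_sub_le [Nontrivial E] (hF : LipschitzWith K F)
    (hF0 : F 0 = 0) {δ : ℝ} (hδ : 0 < δ) {v : E} (hv : ‖v‖ ≤ δ) :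
    ∫⁻ z, ‖ballProfile F (z - v) - ballProfile F z‖ₑ
      ≤ ENNReal.ofReal (8 * K * (finrank ℝ E * volume.real (ball (0 : E) 1)) * δ
        + K * (1 + finrank ℝ E) * (δ ^ (2 * finrank ℝ E))⁻¹ * ‖v‖
          * volume.real (ball (0 : E) 1)) := by
  set m : E → ℝ≥0∞ := fun z => ENNReal.ofReal (‖z‖ * (‖z‖ ^ finrank ℝ E)⁻¹) with hm
  have hmm : Measurable m := by fun_prop
  set c : ℝ := finrank ℝ E * volume.real (ball (0 : E) 1) with hc
  have hc0 : 0 ≤ c := by positivity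
  have hS : ∀ a b : ℝ, MeasurableSet ((fun z : E => ‖z‖) ⁻¹' Ico a b) :=
    fun a b => measurable_norm measurableSet_Ico
  have hmi : ∀ a b, Measurable (((fun z : E => ‖z‖) ⁻¹' Ico a b).indicator m) :=
    fun a b => hmm.indicator (hS a b)
  have hI : ∀ a b, a ≤ b → ∫⁻ z, ((fun z : E => ‖z‖) ⁻¹' Ico a b).indicator m z
      ≤ ENNReal.ofReal (c * (b - a)) := fun a b hab => by
    rw [lintegral_indicator (hS a b)]
    exact lintegral_norm_div_pow_le hab
  have hI' : ∀ a b, a ≤ b → ∫⁻ z, ((fun z : E => ‖z‖) ⁻¹' Ico a b).indicator m (z - v)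
      ≤ ENNReal.ofReal (c * (b - a)) := fun a b hab => by
    rw [lintegral_sub_right_eq_self]
    exact hI a b hab
  refine (lintegral_mono (enorm_ballProfile_sub_le hF hF0 hδ hv)).trans ?_
  rw [← hm]
  have hmi' : ∀ a b, Measurable fun z => ((fun z : E => ‖z‖) ⁻¹' Ico a b).indicator m (z - v) :=
    fun a b => (hmi a b).comp (measurable_id.sub_const v)
  have hadd : Measurable fun z => ((fun z : E => ‖z‖) ⁻¹' Ico 0 (2 * δ)).indicator m z
      + ((fun z : E => ‖z‖) ⁻¹' Ico (1 - δ) 1).indicator m z := (hmi _ _).add (hmi _ _)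
  rw [lintegral_add_right _ (measurable_const.indicator measurableSet_ball),
    lintegral_const_mul' _ _ ENNReal.coe_ne_top, lintegral_add_left hadd,
    lintegral_add_left (hmi _ _),
    lintegral_add_left (hmi' _ _), lintegral_indicator_const measurableSet_ball,
    ENNReal.ofReal_add (by positivity) (by positivity),
    ENNReal.ofReal_mul (q := volume.real _) (by positivity), ofReal_measureReal]
  refine add_le_add ?_ le_rfl
  calc _ ≤ (K : ℝ≥0∞) * ((ENNReal.ofReal (c * (2 * δ - 0)) + ENNReal.ofReal (c * (1 - (1 - δ))))
        + (ENNReal.ofReal (c * (3 * δ - 0)) + ENNReal.ofReal (c * (1 - (1 - 2 * δ))))) := by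
        gcongr
        · exact hI _ _ (by linarith)
        · exact hI _ _ (by linarith)
        · exact hI' _ _ (by linarith)
        · exact hI' _ _ (by linarith)
    _ = _ := by
        have h1 : 0 ≤ c * (2 * δ - 0) := mul_nonneg hc0 (by linarith)
        have h2 : 0 ≤ c * (1 - (1 - δ)) := mul_nonneg hc0 (by linarith)
        have h3 : 0 ≤ c * (3 * δ - 0) := mul_nonneg hc0 (by linarith)
        have h4 : 0 ≤ c * (1 - (1 - 2 * δ)) := mul_nonneg hc0 (by linarith)
        rw [← ENNReal.ofReal_coe_nnreal, ← ENNReal.ofReal_add h1 h2, ← ENNReal.ofReal_add h3 h4,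
          ← ENNReal.ofReal_add (by positivity) (by positivity),
          ← ENNReal.ofReal_mul (by positivity)]
        congr 1
        ring

theorem exists_isDilationProfile_ballProfile [Nontrivial E] (hF : LipschitzWith K F)
    (hF0 : F 0 = 0) (hInt : ∫ z, ballProfile F z = 0) :
    ∃ C, 0 ≤ C ∧ IsDilationProfile (ballProfile F) C (1 / (2 * finrank ℝ E + 1)) := by
  set n := finrank ℝ E with hn
  set c : ℝ := n * volume.real (ball (0 : E) 1) with hc
  have hc0 : 0 ≤ c := by positivity
  have hm := measurable_ballProfile hF
  have hle := lintegral_enorm_ballProfile_le hF hF0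
  set ε : ℝ := 1 / (2 * n + 1) with hε
  have hε0 : 0 < ε := by positivity
  have hε1 : ε ≤ 1 := by
    rw [hε, div_le_one (by positivity)]
    linarith [(Nat.cast_nonneg n : (0 : ℝ) ≤ n)]
  refine ⟨8 * K * c + K * (1 + n) * volume.real (ball (0 : E) 1), by positivity, hm,
    ⟨hm.aestronglyMeasurable, hle.trans_lt ENNReal.ofReal_lt_top⟩, fun z hz => ?_, hInt,
    hle.trans (ENNReal.ofReal_le_ofReal ?_), fun v => ?_⟩
  · rw [ballProfile, indicator_of_notMem (by simpa using hz)]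
  · have : 0 ≤ K * (1 + n) * volume.real (ball (0 : E) 1) := by positivity
    nlinarith [mul_nonneg K.coe_nonneg hc0]
  rcases eq_or_ne v 0 with rfl | hv
  · simp
  have hv0 : 0 < ‖v‖ := norm_pos_iff.2 hv
  rcases le_or_gt ‖v‖ 1 with hv1 | hv1
  · have hδ : ‖v‖ ≤ ‖v‖ ^ ε := by
      simpa using Real.rpow_le_rpow_of_exponent_ge hv0 hv1 hε1
    refine (lintegral_enorm_ballProfile_sub_le hF hF0 (by positivity) hδ).trans
      (ENNReal.ofReal_le_ofReal (le_of_eq ?_))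
    have : ((‖v‖ ^ ε) ^ (2 * n))⁻¹ * ‖v‖ = ‖v‖ ^ ε := by
      rw [← Real.rpow_natCast, ← Real.rpow_mul hv0.le, ← Real.rpow_neg hv0.le]
      nth_rewrite 2 [← Real.rpow_one ‖v‖]
      rw [← Real.rpow_add hv0]
      congr 1
      rw [hε]
      push_cast
      field_simp
      ring
    rw [← hn, ← hc]
    linear_combination (K * (1 + n) * volume.real (ball (0 : E) 1)) * this
  · have hone : 1 ≤ ‖v‖ ^ ε := Real.one_le_rpow hv1.le hε0.le
    calc ∫⁻ z, ‖ballProfile F (z - v) - ballProfile F z‖ₑ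
        ≤ ∫⁻ z, (‖ballProfile F (z - v)‖ₑ + ‖ballProfile F z‖ₑ) :=
          lintegral_mono fun z => enorm_sub_le
      _ ≤ ENNReal.ofReal (K * c) + ENNReal.ofReal (K * c) := by
          rw [lintegral_add_right _ hm.enorm,
            lintegral_sub_right_eq_self fun z => ‖ballProfile F z‖ₑ]
          exact add_le_add hle hle
      _ ≤ _ := by
          rw [← ENNReal.ofReal_add (by positivity) (by positivity)]
          refine ENNReal.ofReal_le_ofReal ?_
          have h1 : 0 ≤ K * (1 + n) * volume.real (ball (0 : E) 1) := by positivity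
          have h2 : 0 ≤ K * c := by positivity
          calc K * c + K * c ≤ (8 * K * c + K * (1 + n) * volume.real (ball (0 : E) 1)) * 1 := by
                linarith
            _ ≤ _ := by gcongr

end HomogeneousProfile

section SphereMeasure

open Metric Set Module

theorem norm_inv_norm_smul_sub_le {V : Type*} [NormedAddCommGroup V] [NormedSpace ℝ V] {x y : V}
    (hx : 1 ≤ ‖x‖) (hy : 1 ≤ ‖y‖) : ‖‖x‖⁻¹ • x - ‖y‖⁻¹ • y‖ ≤ 2 * ‖x - y‖ := by
  have hx0 : 0 < ‖x‖ := by linarith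
  have hy0 : 0 < ‖y‖ := by linarith
  have hinv : ‖x‖⁻¹ ≤ 1 := inv_le_one_of_one_le₀ hx
  have heq : ‖x‖⁻¹ • x - ‖y‖⁻¹ • y = ‖x‖⁻¹ • (x - y) + (‖x‖⁻¹ - ‖y‖⁻¹) • y := by
    rw [smul_sub, sub_smul]; abel
  have h2 : ‖(‖x‖⁻¹ - ‖y‖⁻¹) • y‖ ≤ ‖x - y‖ := by
    rw [norm_smul, Real.norm_eq_abs, inv_sub_inv hx0.ne' hy0.ne', abs_div,
      abs_of_pos (by positivity : 0 < ‖x‖ * ‖y‖)]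
    have : |‖y‖ - ‖x‖| ≤ ‖x - y‖ := by
      rw [abs_sub_comm]; exact abs_norm_sub_norm_le x y
    calc |‖y‖ - ‖x‖| / (‖x‖ * ‖y‖) * ‖y‖ = ‖x‖⁻¹ * |‖y‖ - ‖x‖| := by field_simp
      _ ≤ 1 * ‖x - y‖ := by gcongr
      _ = ‖x - y‖ := one_mul _
  calc ‖‖x‖⁻¹ • x - ‖y‖⁻¹ • y‖ ≤ ‖‖x‖⁻¹ • (x - y)‖ + ‖(‖x‖⁻¹ - ‖y‖⁻¹) • y‖ :=
        heq ▸ norm_add_le _ _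
    _ ≤ 1 * ‖x - y‖ + ‖x - y‖ := by
        rw [norm_smul, Real.norm_of_nonneg (by positivity)]
        gcongr
    _ = _ := by ring

/-- The central projection of the hyperplane `{x i = s}` to the unit sphere. -/
noncomputable def faceProjection {n : ℕ} (i : Fin (n + 1)) (s : ℝ) (y : Fin n → ℝ) :
    EuclideanSpace ℝ (Fin (n + 1)) :=
  ‖WithLp.toLp 2 (i.insertNth s y : Fin (n + 1) → ℝ)‖⁻¹ •
    WithLp.toLp 2 (i.insertNth s y : Fin (n + 1) → ℝ)

theorem exists_lipschitzWith_faceProjection {n : ℕ} (i : Fin (n + 1)) {s : ℝ} (hs : |s| = 1) :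
    ∃ C, LipschitzWith C (faceProjection (n := n) i s) := by
  have hone : ∀ y : Fin n → ℝ, 1 ≤ ‖WithLp.toLp 2 (i.insertNth s y : Fin (n + 1) → ℝ)‖ := by
    intro y
    have := PiLp.norm_apply_le (WithLp.toLp 2 (i.insertNth s y : Fin (n + 1) → ℝ)) i
    simpa [hs] using this
  have hins : LipschitzWith 1 fun y : Fin n → ℝ => (i.insertNth s y : Fin (n + 1) → ℝ) := by
    refine LipschitzWith.mk_one fun x y => ?_
    refine (dist_pi_le_iff dist_nonneg).2 fun j => ?_
    refine Fin.succAboveCases i ?_ (fun k => ?_) j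
    · simp
    · simpa using dist_le_pi_dist x y k
  obtain ⟨C, hlip⟩ : ∃ C, LipschitzWith C
      fun y : Fin n → ℝ => WithLp.toLp 2 (i.insertNth s y : Fin (n + 1) → ℝ) :=
    ⟨_, (PiLp.lipschitzWith_toLp 2 fun _ : Fin (n + 1) => ℝ).comp hins⟩
  refine ⟨2 * C, LipschitzWith.of_dist_le_mul fun x y => ?_⟩
  rw [dist_eq_norm, NNReal.coe_mul, mul_assoc]
  refine (norm_inv_norm_smul_sub_le (hone x) (hone y)).trans ?_
  rw [← dist_eq_norm]
  exact mul_le_mul_of_nonneg_left (hlip.dist_le_mul x y) zero_le_two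

theorem sphere_subset_iUnion_faceProjection (n : ℕ) :
    sphere (0 : EuclideanSpace ℝ (Fin (n + 1))) 1 ⊆
      ⋃ i : Fin (n + 1), (faceProjection i 1 '' closedBall 0 1)
        ∪ (faceProjection i (-1) '' closedBall 0 1) := by
  intro ω hω
  have hω1 : ‖ω‖ = 1 := by simpa using hω
  obtain ⟨i, hi⟩ := Finite.exists_max fun i => |ω i|
  have hi0 : 0 < |ω i| := by
    refine (abs_nonneg _).lt_of_ne fun h => ?_
    have : ω = 0 := by
      ext j
      have := hi j
      rw [← h] at this
      exact abs_nonpos_iff.1 this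
    rw [this, norm_zero] at hω1
    exact zero_ne_one hω1
  have key : ∀ s : ℝ, s * |ω i| = ω i →
      ω ∈ faceProjection i s '' closedBall (0 : Fin n → ℝ) 1 := by
    intro s hs
    refine ⟨fun k => |ω i|⁻¹ * ω (i.succAbove k), ?_, ?_⟩
    · rw [mem_closedBall_zero_iff, pi_norm_le_iff_of_nonneg zero_le_one]
      intro k
      rw [norm_mul, norm_inv, norm_abs_eq_norm, Real.norm_eq_abs, Real.norm_eq_abs,
        inv_mul_le_one₀ hi0]
      exact hi _
    · have : WithLp.toLp 2 (i.insertNth s (fun k => |ω i|⁻¹ * ω (i.succAbove k))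
          : Fin (n + 1) → ℝ) = |ω i|⁻¹ • ω := by
        ext j
        refine Fin.succAboveCases i ?_ (fun k => ?_) j
        · simp only [Fin.insertNth_apply_same, PiLp.smul_apply, smul_eq_mul]
          nth_rewrite 2 [← hs]
          field_simp
        · simp
      rw [faceProjection, this, norm_smul, hω1, norm_inv, norm_abs_eq_norm, Real.norm_eq_abs,
        mul_one, inv_inv, smul_smul, mul_inv_cancel₀ hi0.ne', one_smul]
  refine mem_iUnion.2 ⟨i, ?_⟩
  rcases le_or_gt 0 (ω i) with h | h
  · exact Or.inl (key 1 (by rw [abs_of_nonneg h, one_mul]))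
  · exact Or.inr (key (-1) (by rw [abs_of_neg h]; ring))

theorem hausdorffMeasure_sphere_lt_top (n : ℕ) :
    μH[(n : ℝ)] (sphere (0 : EuclideanSpace ℝ (Fin (n + 1))) 1) < ⊤ := by
  have hface : ∀ (i : Fin (n + 1)) (s : ℝ), |s| = 1 →
      μH[(n : ℝ)] (faceProjection i s '' closedBall (0 : Fin n → ℝ) 1) < ⊤ := by
    intro i s hs
    obtain ⟨C, hC⟩ := exists_lipschitzWith_faceProjection (n := n) i hs
    refine (hC.hausdorffMeasure_image_le (Nat.cast_nonneg n) _).trans_lt ?_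
    have : (μH[(n : ℝ)] : Measure (Fin n → ℝ)) = volume := by
      have := hausdorffMeasure_pi_real (ι := Fin n)
      rwa [Fintype.card_fin] at this
    rw [this, ENNReal.rpow_natCast]
    exact ENNReal.mul_lt_top (ENNReal.pow_lt_top ENNReal.coe_lt_top) measure_closedBall_lt_top
  refine (measure_mono (sphere_subset_iUnion_faceProjection n)).trans_lt ?_
  refine (measure_iUnion_le _).trans_lt ?_
  rw [tsum_fintype]
  refine ENNReal.sum_lt_top.2 fun i _ => (measure_union_le _ _).trans_lt ?_
  exact ENNReal.add_lt_top.2 ⟨hface i 1 (by simp), hface i (-1) (by simp)⟩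

theorem isFiniteMeasure_hausdorffMeasure_sphere {d : ℕ} (hd : d ≠ 0) :
    IsFiniteMeasure ((μH[(d : ℝ) - 1]).restrict (sphere (0 : EuclideanSpace ℝ (Fin d)) 1)) := by
  obtain ⟨n, rfl⟩ := Nat.exists_eq_succ_of_ne_zero hd
  refine ⟨?_⟩
  rw [Measure.restrict_apply_univ, Nat.succ_eq_add_one, Nat.cast_succ, add_sub_cancel_right]
  exact hausdorffMeasure_sphere_lt_top n

theorem integral_sphere_comp_isometry {d : ℕ} (s : ℝ)
    (e : EuclideanSpace ℝ (Fin d) ≃ₗᵢ[ℝ] EuclideanSpace ℝ (Fin d))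
    (f : EuclideanSpace ℝ (Fin d) → ℝ) :
    ∫ ω in sphere 0 1, f (e ω) ∂μH[s] = ∫ ω in sphere 0 1, f ω ∂μH[s] := by
  have hpre : e ⁻¹' sphere 0 1 = sphere 0 1 := by ext; simp
  have := (e.toIsometryEquiv.measurePreserving_hausdorffMeasure s).setIntegral_preimage_emb
    e.toHomeomorph.measurableEmbedding f (sphere 0 1)
  simp only [LinearIsometryEquiv.coe_toIsometryEquiv, hpre] at this
  exact this

theorem integral_sphere_mul_coord_of_ne {d : ℕ} (s : ℝ) {k l : Fin d} (hkl : k ≠ l) :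
    ∫ ω in sphere (0 : EuclideanSpace ℝ (Fin d)) 1, ω k * ω l ∂μH[s] = 0 := by
  have := integral_sphere_comp_isometry s (LinearIsometryEquiv.piLpCongrRight 2 fun i : Fin d =>
    if i = k then LinearIsometryEquiv.neg ℝ else LinearIsometryEquiv.refl ℝ ℝ)
    fun ω => ω k * ω l
  simp only [LinearIsometryEquiv.piLpCongrRight_apply, if_true, if_neg hkl.symm,
    LinearIsometryEquiv.coe_neg, LinearIsometryEquiv.coe_refl, id, neg_mul, integral_neg] at this
  linarith

theorem integral_sphere_coord_sq_eq {d : ℕ} (s : ℝ) (k l : Fin d) :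
    ∫ ω in sphere (0 : EuclideanSpace ℝ (Fin d)) 1, ω k * ω k ∂μH[s]
      = ∫ ω in sphere (0 : EuclideanSpace ℝ (Fin d)) 1, ω l * ω l ∂μH[s] := by
  rw [← integral_sphere_comp_isometry s
    (LinearIsometryEquiv.piLpCongrLeft 2 ℝ ℝ (Equiv.swap k l)) fun ω => ω k * ω k]
  simp [LinearIsometryEquiv.piLpCongrLeft_apply, Equiv.piCongrLeft']

theorem integrableOn_sphere_of_continuous {d : ℕ} (hd : d ≠ 0)
    {f : EuclideanSpace ℝ (Fin d) → ℝ} (hf : Continuous f) :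
    IntegrableOn f (sphere 0 1) (μH[(d : ℝ) - 1]) := by
  have := isFiniteMeasure_hausdorffMeasure_sphere hd
  obtain ⟨M, hM⟩ := (isCompact_sphere (0 : EuclideanSpace ℝ (Fin d)) 1).exists_bound_of_continuousOn
    hf.continuousOn
  refine Integrable.of_bound hf.aestronglyMeasurable M ?_
  filter_upwards [ae_restrict_mem isClosed_sphere.measurableSet] with ω hω using hM ω hω

theorem integral_sphere_traceless {d : ℕ} (hd : d ≠ 0) (k l : Fin d) :
    ∫ ω in sphere (0 : EuclideanSpace ℝ (Fin d)) 1,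
      (ω k * ω l - if k = l then 1 / (d : ℝ) else 0) ∂μH[(d : ℝ) - 1] = 0 := by
  have := isFiniteMeasure_hausdorffMeasure_sphere hd
  have hInt : ∀ i j : Fin d, IntegrableOn (fun ω : EuclideanSpace ℝ (Fin d) => ω i * ω j)
      (sphere 0 1) (μH[(d : ℝ) - 1]) := fun i j =>
    integrableOn_sphere_of_continuous hd (by fun_prop)
  rw [integral_sub (hInt k l) (integrable_const _)]
  rcases eq_or_ne k l with rfl | hkl
  · have hsum : ∑ i, ∫ ω in sphere (0 : EuclideanSpace ℝ (Fin d)) 1, ω i * ω i ∂μH[(d : ℝ) - 1]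
        = ∫ ω in sphere (0 : EuclideanSpace ℝ (Fin d)) 1, 1 ∂μH[(d : ℝ) - 1] := by
      rw [← integral_finsetSum _ fun i _ => hInt i i]
      refine setIntegral_congr_fun isClosed_sphere.measurableSet fun ω hω => ?_
      have : ‖ω‖ = 1 := by simpa using hω
      have h2 := EuclideanSpace.real_norm_sq_eq ω
      rw [this] at h2
      simp only [← sq]
      linarith
    rw [Finset.sum_congr rfl fun i _ => integral_sphere_coord_sq_eq _ i k, Finset.sum_const,
      Finset.card_univ, Fintype.card_fin, nsmul_eq_mul] at hsum
    have hd' : (d : ℝ) ≠ 0 := by exact_mod_cast hd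
    simp only [if_true, integral_const, smul_eq_mul, mul_one] at hsum ⊢
    rw [← hsum]
    field_simp
    ring
  · simp [integral_sphere_mul_coord_of_ne _ hkl, hkl]

end SphereMeasure

section SphereAverage

open Metric Set Module

variable {d : ℕ} {Ψ : EuclideanSpace ℝ (Fin d) × EuclideanSpace ℝ (Fin d) → ℝ} {K : NNReal}

/-- The integral of `Ψ(z, ·)` over the unit sphere. -/
noncomputable def sphereIntegral
    (Ψ : EuclideanSpace ℝ (Fin d) × EuclideanSpace ℝ (Fin d) → ℝ)
    (z : EuclideanSpace ℝ (Fin d)) : ℝ :=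
  ∫ ω in sphere 0 1, Ψ (z, ω) ∂μH[(d : ℝ) - 1]

theorem exists_lipschitzWith_sphereIntegral (hd : d ≠ 0) (hΨ : LipschitzWith K Ψ) :
    ∃ C, LipschitzWith C (sphereIntegral Ψ) := by
  have := isFiniteMeasure_hausdorffMeasure_sphere hd
  have hΨc := hΨ.continuous
  set m : ℝ := (μH[(d : ℝ) - 1]).real (sphere (0 : EuclideanSpace ℝ (Fin d)) 1)
  refine ⟨K * m.toNNReal, LipschitzWith.of_dist_le_mul fun x y => ?_⟩
  rw [dist_eq_norm, sphereIntegral, sphereIntegral, ← integral_sub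
    (integrableOn_sphere_of_continuous hd (by fun_prop))
    (integrableOn_sphere_of_continuous hd (by fun_prop))]
  have hbound : ∀ ω ∈ sphere (0 : EuclideanSpace ℝ (Fin d)) 1,
      ‖Ψ (x, ω) - Ψ (y, ω)‖ ≤ K * dist x y := fun ω _ => by
    have := hΨ.dist_le_mul (x, ω) (y, ω)
    rwa [Prod.dist_eq, dist_self, max_eq_left dist_nonneg, dist_eq_norm (Ψ _)] at this
  refine (norm_setIntegral_le_of_norm_le_const ?_ hbound).trans (le_of_eq ?_)
  · simpa using measure_lt_top ((μH[(d : ℝ) - 1]).restrict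
      (sphere (0 : EuclideanSpace ℝ (Fin d)) 1)) univ
  · rw [NNReal.coe_mul, Real.coe_toNNReal m measureReal_nonneg]
    ring

theorem sphereIntegral_zero
    (hΨ0 : ∀ ω ∈ sphere (0 : EuclideanSpace ℝ (Fin d)) 1, Ψ (0, ω) = 0) :
    sphereIntegral Ψ 0 = 0 := by
  rw [sphereIntegral, setIntegral_congr_fun isClosed_sphere.measurableSet hΨ0, integral_zero]

theorem integral_ballProfile_sphereIntegral (hd : d ≠ 0) (hΨ : LipschitzWith K Ψ)
    (hΨ0 : ∀ ω ∈ sphere (0 : EuclideanSpace ℝ (Fin d)) 1, Ψ (0, ω) = 0) :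
    ∫ z, ballProfile (sphereIntegral Ψ) z
      = ∫ ω in sphere (0 : EuclideanSpace ℝ (Fin d)) 1, (∫ z in ball 0 1,
          (‖z‖ ^ d)⁻¹ * Ψ (z, ω)) ∂μH[(d : ℝ) - 1] := by
  have := isFiniteMeasure_hausdorffMeasure_sphere hd
  have : Nonempty (Fin d) := ⟨⟨0, Nat.pos_of_ne_zero hd⟩⟩
  have hΨm := hΨ.continuous.measurable
  simp only [ballProfile, finrank_euclideanSpace, Fintype.card_fin, sphereIntegral]
  rw [integral_indicator measurableSet_ball]
  simp only [← integral_const_mul]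
  refine integral_integral_swap
    (μ := volume.restrict (ball (0 : EuclideanSpace ℝ (Fin d)) 1))
    (ν := (μH[(d : ℝ) - 1]).restrict (sphere (0 : EuclideanSpace ℝ (Fin d)) 1))
    (f := fun z ω => (‖z‖ ^ d)⁻¹ * Ψ (z, ω)) ?_
  have hball : ball (0 : EuclideanSpace ℝ (Fin d)) 1 = (fun z => ‖z‖) ⁻¹' Ico 0 1 := by
    ext z; simp
  have hInt : IntegrableOn (fun z : EuclideanSpace ℝ (Fin d) => ‖z‖ * (‖z‖ ^ d)⁻¹)
      (ball 0 1) := by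
    have hle := lintegral_norm_div_pow_le (E := EuclideanSpace ℝ (Fin d)) zero_le_one
    rw [← hball, finrank_euclideanSpace, Fintype.card_fin] at hle
    refine ⟨by fun_prop, ?_⟩
    rw [hasFiniteIntegral_iff_ofReal (Filter.Eventually.of_forall fun z => by positivity)]
    exact hle.trans_lt ENNReal.ofReal_lt_top
  refine ((hInt.const_mul (K : ℝ)).comp_fst _).mono' ?_ ?_
  · exact Measurable.aestronglyMeasurable (by fun_prop)
  · have hmem : ∀ᵐ p ∂(volume.restrict (ball (0 : EuclideanSpace ℝ (Fin d)) 1)).prod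
        ((μH[(d : ℝ) - 1]).restrict (sphere (0 : EuclideanSpace ℝ (Fin d)) 1)),
        p.2 ∈ sphere (0 : EuclideanSpace ℝ (Fin d)) 1 :=
      Measure.quasiMeasurePreserving_snd.ae (ae_restrict_mem isClosed_sphere.measurableSet)
    filter_upwards [hmem] with ⟨z, ω⟩ hω
    have hle : ‖Ψ (z, ω)‖ ≤ K * ‖z‖ := by
      have := hΨ.dist_le_mul (z, ω) (0, ω)
      rwa [Prod.dist_eq, dist_self, max_eq_left dist_nonneg, hΨ0 ω hω, dist_zero_right,
        dist_zero_right] at this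
    simp only [Function.uncurry_apply_pair]
    rw [norm_mul, Real.norm_of_nonneg (by positivity)]
    calc (‖z‖ ^ d)⁻¹ * ‖Ψ (z, ω)‖ ≤ (‖z‖ ^ d)⁻¹ * (K * ‖z‖) := by gcongr
      _ = _ := by ring

theorem rpow_one_sub_natCast {t : ℝ} (ht : 0 < t) (d : ℕ) :
    t ^ (1 - (d : ℝ)) = (t ^ d)⁻¹ * t := by
  rw [Real.rpow_sub ht, Real.rpow_one, Real.rpow_natCast, div_eq_inv_mul]

theorem measurable_dilationWeight (d : ℕ) (h : ℝ) :
    Measurable fun r : ℝ => r ^ d / (r + h) ^ (d + 1) := by fun_prop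

theorem abs_dilationWeight_le (d : ℕ) {h r : ℝ} (hh : 0 < h) (hr : r ∈ Ioc (0 : ℝ) 1) :
    |r ^ d / (r + h) ^ (d + 1)| ≤ r⁻¹ := by
  have hr0 := hr.1
  rw [abs_of_nonneg (by positivity), div_le_iff₀ (by positivity)]
  calc r ^ d = r⁻¹ * r ^ (d + 1) := by rw [pow_succ]; field_simp
    _ ≤ r⁻¹ * (r + h) ^ (d + 1) := by gcongr; linarith

theorem integrableOn_dilationWeight (d : ℕ) {h : ℝ} (hh : 0 < h) :
    IntegrableOn (fun r : ℝ => r ^ d / (r + h) ^ (d + 1)) (Ioc 0 1) := by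
  refine ContinuousOn.integrableOn_Icc ?_ |>.mono_set Ioc_subset_Icc_self
  refine ContinuousOn.div (by fun_prop) (by fun_prop) fun r hr => ?_
  have := hr.1
  positivity

theorem integral_dilationKernel_mul_add {E : Type*} [NormedAddCommGroup E]
    [InnerProductSpace ℝ E] [FiniteDimensional ℝ E] [MeasurableSpace E] [BorelSpace E]
    {w : ℝ → ℝ} {φ f : E → ℝ} (hw : Measurable w) (hwi : IntegrableOn w (Ioc 0 1))
    (hφ : Measurable φ) (hφi : Integrable φ) (hf : Continuous f) {M : ℝ} (hM : ∀ y, ‖f y‖ ≤ M)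
    (x : E) :
    ((fun y => dilationKernel w φ (-y)) ⋆ f) x
      = ∫ r in Ioc (0 : ℝ) 1, w r * ∫ z, φ z * f (x + r • z) := by
  rw [convolution_real_apply, ← integral_neg_eq_self]
  simp only [neg_neg, sub_neg_eq_add]
  exact integral_dilationKernel_smul hw hwi hφ hφi (g := fun y => f (x + y)) (by fun_prop)
    fun y => hM _

end SphereAverage

section Reduction

open Metric Set Module

theorem exists_lipschitz_coord_extension {d : ℕ}
    {L : EuclideanSpace ℝ (Fin d) → EuclideanSpace ℝ (Fin d) →
      EuclideanSpace ℝ (Fin d × Fin d)} {K : NNReal}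
    (hL : LipschitzOnWith K
      (fun q : EuclideanSpace ℝ (Fin d) × EuclideanSpace ℝ (Fin d) => ‖q.1‖ • L q.1 q.2)
      (ball 0 1 ×ˢ sphere 0 1)) (kl : Fin d × Fin d) :
    ∃ Ψ : EuclideanSpace ℝ (Fin d) × EuclideanSpace ℝ (Fin d) → ℝ, LipschitzWith K Ψ ∧
      ∀ z ∈ ball (0 : EuclideanSpace ℝ (Fin d)) 1, ∀ ω ∈ sphere (0 : EuclideanSpace ℝ (Fin d)) 1,
        Ψ (z, ω) = ‖z‖ * L z ω kl := by
  have hcoord : LipschitzOnWith K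
      (fun q : EuclideanSpace ℝ (Fin d) × EuclideanSpace ℝ (Fin d) => (‖q.1‖ • L q.1 q.2) kl)
      (ball 0 1 ×ˢ sphere 0 1) := by
    refine LipschitzOnWith.of_dist_le_mul fun p hp q hq => ?_
    refine le_trans ?_ (hL.dist_le_mul p hp q hq)
    rw [dist_eq_norm, dist_eq_norm, ← PiLp.sub_apply]
    exact PiLp.norm_apply_le _ kl
  obtain ⟨Ψ, hΨ, heq⟩ := hcoord.extend_real
  refine ⟨Ψ, hΨ, fun z hz ω hω => ?_⟩
  rw [← heq (mk_mem_prod hz hω)]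
  simp

theorem integrable_mul_integral_profile {E : Type*} [NormedAddCommGroup E]
    [InnerProductSpace ℝ E] [FiniteDimensional ℝ E] [MeasurableSpace E] [BorelSpace E]
    {w : ℝ → ℝ} {φ f : E → ℝ} (hwi : IntegrableOn w (Ioc 0 1))
    (hφ : Measurable φ) (hφi : Integrable φ) (hf : Continuous f) {M : ℝ} (hM : ∀ y, ‖f y‖ ≤ M)
    (x : E) :
    IntegrableOn (fun r => w r * ∫ z, φ z * f (x + r • z)) (Ioc 0 1) := by
  have hfm := hf.measurable
  have hm : Measurable fun p : ℝ × E => φ p.2 * f (x + p.1 • p.2) := by fun_prop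
  refine Integrable.mul_bdd (c := (∫ z, ‖φ z‖) * M) hwi
    hm.stronglyMeasurable.integral_prod_right.aestronglyMeasurable
    (Filter.Eventually.of_forall fun r => ?_)
  rw [← integral_mul_const]
  refine norm_integral_le_of_norm_le (hφi.norm.mul_const M)
    (Filter.Eventually.of_forall fun z => ?_)
  rw [norm_mul]
  exact mul_le_mul_of_nonneg_left (hM _) (norm_nonneg _)

theorem Qop_one_eq_sum_convolution {d : ℕ} (hd : d ≠ 0)
    {L : EuclideanSpace ℝ (Fin d) → EuclideanSpace ℝ (Fin d) →
      EuclideanSpace ℝ (Fin d × Fin d)} {K : NNReal}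
    {Ψ : Fin d × Fin d → EuclideanSpace ℝ (Fin d) × EuclideanSpace ℝ (Fin d) → ℝ}
    (hΨ : ∀ kl, LipschitzWith K (Ψ kl))
    (hΨL : ∀ kl, ∀ z ∈ ball (0 : EuclideanSpace ℝ (Fin d)) 1,
      ∀ ω ∈ sphere (0 : EuclideanSpace ℝ (Fin d)) 1, Ψ kl (z, ω) = ‖z‖ * L z ω kl)
    (hφm : ∀ kl, Measurable (ballProfile (sphereIntegral (Ψ kl))))
    (hφi : ∀ kl, Integrable (ballProfile (sphereIntegral (Ψ kl))))
    {h : ℝ} (hh : 0 < h) {A : EuclideanSpace ℝ (Fin d) → EuclideanSpace ℝ (Fin d × Fin d)}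
    (hA : Continuous A) {M : ℝ} (hM : ∀ y, ‖A y‖ ≤ M) (x : EuclideanSpace ℝ (Fin d)) :
    Qop d h L A (fun _ => 1) x
      = ∑ kl, ((fun y => dilationKernel (fun r => r ^ d / (r + h) ^ (d + 1))
          (ballProfile (sphereIntegral (Ψ kl))) (-y)) ⋆ (fun y => A y kl)) x := by
  have : Nonempty (Fin d) := ⟨⟨0, Nat.pos_of_ne_zero hd⟩⟩
  set w : ℝ → ℝ := fun r => r ^ d / (r + h) ^ (d + 1) with hw
  have hwm : Measurable w := measurable_dilationWeight d h
  have hwi : IntegrableOn w (Ioc 0 1) := integrableOn_dilationWeight d hh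
  have hAc : ∀ kl, Continuous fun y => A y kl := fun kl => by fun_prop
  have hAM : ∀ kl y, ‖A y kl‖ ≤ M := fun kl y => (PiLp.norm_apply_le _ kl).trans (hM y)
  have hprod : ∀ kl (r : ℝ), Integrable fun z =>
      ballProfile (sphereIntegral (Ψ kl)) z * A (x + r • z) kl := fun kl r =>
    (hφi kl).mul_bdd (c := M) ((hAc kl).comp (by fun_prop)).aestronglyMeasurable
      (Filter.Eventually.of_forall fun z => hAM kl _)
  rw [Finset.sum_congr rfl fun kl _ => integral_dilationKernel_mul_add hwm hwi (hφm kl) (hφi kl)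
    (hAc kl) (hAM kl) x, ← integral_finsetSum _ fun kl _ =>
    integrable_mul_integral_profile hwi (hφm kl) (hφi kl) (hAc kl) (hAM kl) x]
  refine setIntegral_congr_fun measurableSet_Ioc fun r hr => ?_
  simp only [← integral_const_mul]
  rw [← integral_finsetSum _ fun kl _ => (hprod kl r).const_mul _]
  refine Eq.trans ?_ (setIntegral_eq_integral_of_forall_compl_eq_zero (s := ball 0 1) ?_)
  · refine setIntegral_congr_ae measurableSet_ball ?_
    filter_upwards [Measure.ae_ne volume (0 : EuclideanSpace ℝ (Fin d))] with z hz0 hz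
    have hzn : 0 < ‖z‖ := norm_pos_iff.2 hz0
    calc ∫ ω in sphere (0 : EuclideanSpace ℝ (Fin d)) 1,
          w r * ‖z‖ ^ (1 - (d : ℝ)) * (∑ kl, L z ω kl * A (x + r • z) kl) * 1 ∂μH[(d : ℝ) - 1]
        = ∫ ω in sphere (0 : EuclideanSpace ℝ (Fin d)) 1,
          ∑ kl, (w r * ((‖z‖ ^ d)⁻¹ * A (x + r • z) kl)) * Ψ kl (z, ω) ∂μH[(d : ℝ) - 1] := by
          refine setIntegral_congr_fun isClosed_sphere.measurableSet fun ω hω => ?_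
          simp only [mul_one, Finset.mul_sum, rpow_one_sub_natCast hzn]
          refine Finset.sum_congr rfl fun kl _ => ?_
          rw [hΨL kl z hz ω hω]
          ring
      _ = ∑ kl, w r * (ballProfile (sphereIntegral (Ψ kl)) z * A (x + r • z) kl) := by
          have hΨi : ∀ kl, IntegrableOn (fun ω => Ψ kl (z, ω)) (sphere 0 1)
              (μH[(d : ℝ) - 1]) := fun kl =>
            integrableOn_sphere_of_continuous hd ((hΨ kl).continuous.comp (by fun_prop))
          rw [integral_finsetSum _ fun kl _ => (hΨi kl).const_mul _]
          refine Finset.sum_congr rfl fun kl _ => ?_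
          rw [integral_const_mul, ballProfile, indicator_of_mem hz, sphereIntegral,
            finrank_euclideanSpace, Fintype.card_fin]
          ring
  · intro z hz
    refine Finset.sum_eq_zero fun kl _ => ?_
    rw [ballProfile, indicator_of_notMem hz, zero_mul, mul_zero]

theorem integral_ballProfile_eq_zero_of_cancellation {d : ℕ} (hd : d ≠ 0)
    {L : EuclideanSpace ℝ (Fin d) → EuclideanSpace ℝ (Fin d) →
      EuclideanSpace ℝ (Fin d × Fin d)} {K : NNReal} {α : ℝ} {k l : Fin d}
    (hcanc : ∀ ω ∈ sphere (0 : EuclideanSpace ℝ (Fin d)) 1,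
      (∫ z in ball (0 : EuclideanSpace ℝ (Fin d)) 1, (‖z‖ ^ (1 - (d : ℝ))) * L z ω (k, l))
        = α * (ω k * ω l - if k = l then 1 / (d : ℝ) else 0))
    {Ψ : EuclideanSpace ℝ (Fin d) × EuclideanSpace ℝ (Fin d) → ℝ} (hΨ : LipschitzWith K Ψ)
    (hΨL : ∀ z ∈ ball (0 : EuclideanSpace ℝ (Fin d)) 1,
      ∀ ω ∈ sphere (0 : EuclideanSpace ℝ (Fin d)) 1, Ψ (z, ω) = ‖z‖ * L z ω (k, l)) :
    ∫ z, ballProfile (sphereIntegral Ψ) z = 0 := by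
  have : Nonempty (Fin d) := ⟨⟨0, Nat.pos_of_ne_zero hd⟩⟩
  rw [integral_ballProfile_sphereIntegral hd hΨ fun ω hω => by
    rw [hΨL 0 (mem_ball_self one_pos) ω hω, norm_zero, zero_mul]]
  have hinner : ∀ ω ∈ sphere (0 : EuclideanSpace ℝ (Fin d)) 1,
      (∫ z in ball (0 : EuclideanSpace ℝ (Fin d)) 1, (‖z‖ ^ d)⁻¹ * Ψ (z, ω))
        = α * (ω k * ω l - if k = l then 1 / (d : ℝ) else 0) := fun ω hω => by
    rw [← hcanc ω hω]
    refine setIntegral_congr_ae measurableSet_ball ?_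
    filter_upwards [Measure.ae_ne volume (0 : EuclideanSpace ℝ (Fin d))] with z hz0 hz
    rw [hΨL z hz ω hω, rpow_one_sub_natCast (norm_pos_iff.2 hz0)]
    ring
  rw [setIntegral_congr_fun isClosed_sphere.measurableSet hinner, integral_const_mul,
    integral_sphere_traceless hd, mul_zero]

end Reduction

/-- `Q(·,1)` is bounded on `L^q(ℝ^d)`, `1 < q < ∞`, uniformly in `h ∈ (0,1/2)`, when the
kernel `L` satisfies the cancellation condition
`∫_{B(0,1)} L(z,ω)|z|^{1−d} dz = α(ω⊗ω − (1/d) Id)`. -/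
theorem Qop_const_bound (d : ℕ) (hd : 2 ≤ d)
    (L : EuclideanSpace ℝ (Fin d) → EuclideanSpace ℝ (Fin d) →
      EuclideanSpace ℝ (Fin d × Fin d))
    (hLbdd : ∃ M : ℝ, ∀ z ∈ Metric.ball (0 : EuclideanSpace ℝ (Fin d)) 1,
      ∀ ω ∈ Metric.sphere (0 : EuclideanSpace ℝ (Fin d)) 1, ‖‖z‖ • L z ω‖ ≤ M)
    (hLlip : ∃ K : NNReal, LipschitzOnWith K
      (fun q : EuclideanSpace ℝ (Fin d) × EuclideanSpace ℝ (Fin d) => ‖q.1‖ • L q.1 q.2)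
      (Metric.ball 0 1 ×ˢ Metric.sphere 0 1))
    (hcanc : ∃ α : ℝ, ∀ ω ∈ Metric.sphere (0 : EuclideanSpace ℝ (Fin d)) 1,
      ∀ k l : Fin d,
        (∫ z in Metric.ball (0 : EuclideanSpace ℝ (Fin d)) 1,
            (‖z‖ ^ (1 - (d : ℝ))) * L z ω (k, l))
          = α * (ω k * ω l - if k = l then 1 / (d : ℝ) else 0))
    (q : ℝ) (hq : 1 < q) :
    ∃ C : ℝ, 0 < C ∧
      ∀ h : ℝ, h ∈ Set.Ioo (0 : ℝ) (1/2) →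
      ∀ A : SchwartzMap (EuclideanSpace ℝ (Fin d)) (EuclideanSpace ℝ (Fin d × Fin d)),
        eLpNorm (Qop d h L (⇑A) (fun _ => 1)) (ENNReal.ofReal q) volume
          ≤ ENNReal.ofReal C * eLpNorm (⇑A) (ENNReal.ofReal q) volume := by
  have hd0 : d ≠ 0 := by omega
  have : Nonempty (Fin d) := ⟨⟨0, by omega⟩⟩
  obtain ⟨K, hK⟩ := hLlip
  obtain ⟨α, hα⟩ := hcanc
  choose Ψ hΨ hΨL using exists_lipschitz_coord_extension hK
  have hprofile : ∀ kl, ∃ C, 0 ≤ C ∧ IsDilationProfile (ballProfile (sphereIntegral (Ψ kl))) C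
      (1 / (2 * Module.finrank ℝ (EuclideanSpace ℝ (Fin d)) + 1)) := by
    intro kl
    obtain ⟨_, hF⟩ := exists_lipschitzWith_sphereIntegral hd0 (hΨ kl)
    refine exists_isDilationProfile_ballProfile hF (sphereIntegral_zero fun ω hω => ?_)
      (integral_ballProfile_eq_zero_of_cancellation hd0 (fun ω hω => hα ω hω kl.1 kl.2)
        (hΨ kl) (hΨL kl))
    rw [hΨL kl 0 (Metric.mem_ball_self one_pos) ω hω, norm_zero, zero_mul]
  choose C hC hφ using hprofile
  choose D hD0 hD using fun kl => exists_eLpNorm_convolution_le (E := EuclideanSpace ℝ (Fin d))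
    (2 * Real.pi * C kl
      + C kl / (1 / (2 * Module.finrank ℝ (EuclideanSpace ℝ (Fin d)) + 1))) hq
  refine ⟨∑ kl, D kl + 1, by
    have := Finset.sum_nonneg fun kl (_ : kl ∈ Finset.univ) => hD0 kl
    linarith, fun h hh A => ?_⟩
  have hker := fun kl => (isCalderonZygmundKernel_dilationKernel (measurable_dilationWeight d h)
    (integrableOn_dilationWeight d hh.1) (fun r hr => abs_dilationWeight_le d hh.1 hr) (hC kl)
    (by positivity) (hφ kl)).comp_neg
  obtain ⟨M, hM⟩ : ∃ M, ∀ y, ‖A y‖ ≤ M := ⟨_, fun y => A.norm_le_seminorm ℝ y⟩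
  have hAM : ∀ kl y, ‖A y kl‖ ≤ M := fun kl y => (PiLp.norm_apply_le _ kl).trans (hM y)
  have hAc : ∀ kl, Continuous fun y => A y kl := fun kl => by
    have := A.continuous
    fun_prop
  have hAi : ∀ kl, Integrable fun y => A y kl := fun kl =>
    A.integrable.mono (hAc kl).aestronglyMeasurable
      (Filter.Eventually.of_forall fun y => PiLp.norm_apply_le _ kl)
  set u : Fin d × Fin d → EuclideanSpace ℝ (Fin d) → ℝ := fun kl =>
    (fun y => dilationKernel (fun r => r ^ d / (r + h) ^ (d + 1))
      (ballProfile (sphereIntegral (Ψ kl))) (-y)) ⋆ (fun y => A y kl)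
  have huc : ∀ kl, AEStronglyMeasurable (u kl) volume := fun kl =>
    (continuous_convolution_of_bounded (hker kl).integrable (hAc kl) (hAM kl)).aestronglyMeasurable
  have hQ : Qop d h L (⇑A) (fun _ => 1) = ∑ kl, u kl := by
    ext x
    rw [Finset.sum_apply]
    exact Qop_one_eq_sum_convolution hd0 hΨ hΨL (fun kl => (hφ kl).measurable)
      (fun kl => (hφ kl).integrable) hh.1 A.continuous hM x
  have hule : ∀ kl, eLpNorm (u kl) (ENNReal.ofReal q) volume
      ≤ ENNReal.ofReal (D kl) * eLpNorm (⇑A) (ENNReal.ofReal q) volume := fun kl => by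
    refine (hD kl _ (hker kl) _ (hAc kl) (hAi kl) ⟨M, hAM kl⟩).trans ?_
    gcongr
    exact eLpNorm_mono fun y => PiLp.norm_apply_le _ kl
  rw [hQ]
  clear_value u
  calc eLpNorm (∑ kl, u kl) (ENNReal.ofReal q) volume
      ≤ ∑ kl, eLpNorm (u kl) (ENNReal.ofReal q) volume :=
        eLpNorm_sum_le (fun kl _ => huc kl) (by simpa using hq.le)
    _ ≤ ∑ kl, ENNReal.ofReal (D kl) * eLpNorm (⇑A) (ENNReal.ofReal q) volume :=
        Finset.sum_le_sum fun kl _ => hule kl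
    _ ≤ _ := by
        rw [← Finset.sum_mul, ← ENNReal.ofReal_sum_of_nonneg fun kl _ => hD0 kl]
        gcongr
        linarith
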